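/- Suppose γ > 0, α ∈ ℝ, 0 < p < ∞, and k is a nonnegative integer with pk + α > −1. For a holomorphic function f on 𝔹_n, define M_γ(R^k f)(z) = sup_{w ∈ D(z,γ)} |(1−|w|²)^k R^k f(w)|. Then f belongs to the generalized Bergman space A^p_α if and only if M_γ(R^k f) ∈ L^p(𝔹_n, dv_α); moreover there is a constant C > 0, depending only on γ, α, p, k, n, such that C^{-1}(|f(0)| + ‖M_γ(R^k f)‖_{L^p(dv_α)}) ≤ ‖f‖_{p,α} ≤ C(|f(0)| + ‖M_γ(R^k f)‖_{L^p(dv_α)}). -/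

import Mathlib

open MeasureTheory Filter Topology
open scoped Classical ENNReal

noncomputable section

/-- `ℂⁿ` with the Euclidean norm. -/
abbrev En (n : ℕ) := EuclideanSpace ℂ (Fin n)

instance (n : ℕ) : MeasurableSpace (En n) := borel _
instance (n : ℕ) : BorelSpace (En n) := ⟨rfl⟩

/-- The Lebesgue volume measure on `ℂⁿ`. -/
def vol (n : ℕ) : Measure (En n) := Measure.addHaar

/-- The open unit ball `𝔹ₙ` of `ℂⁿ`. -/
def uball (n : ℕ) : Set (En n) := Metric.ball 0 1

/-- The Hermitian pairing `⟨z,w⟩ = ∑ⱼ zⱼ * conj wⱼ`. -/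
def herm {n : ℕ} (z w : En n) : ℂ := ∑ j, z j * (starRingEnd ℂ) (w j)

/-- The orthogonal projection `P_z w` onto the line spanned by `z`. -/
def prj {n : ℕ} (z w : En n) : En n :=
  if z = 0 then 0 else (herm w z / herm z z) • z

/-- The Möbius automorphism `φ_z` of the unit ball. -/
def mobius {n : ℕ} (z w : En n) : En n :=
  ((1 : ℂ) / (1 - herm w z)) •
    (z - prj z w - ((Real.sqrt (1 - ‖z‖ ^ 2) : ℝ) : ℂ) • (w - prj z w))

/-- The Bergman metric `β(z,w)`. -/
def bmet {n : ℕ} (z w : En n) : ℝ :=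
  (1 / 2) * Real.log ((1 + ‖mobius z w‖) / (1 - ‖mobius z w‖))

/-- The Bergman metric ball `D(z,γ)`. -/
def Dball {n : ℕ} (z : En n) (γ : ℝ) : Set (En n) :=
  {w | w ∈ uball n ∧ bmet z w < γ}

/-- The normalizing constant `c_α`. -/
def cnorm (n : ℕ) (α : ℝ) : ℝ :=
  if -1 < α then Real.Gamma (n + α + 1) / (n.factorial * Real.Gamma (α + 1)) else 1

/-- The weighted measure `dv_α = c_α (1-|z|²)^α dv` on the unit ball. -/
def measA (n : ℕ) (α : ℝ) : Measure (En n) :=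
  ((vol n).restrict (uball n)).withDensity
    (fun z => ENNReal.ofReal (cnorm n α * (1 - ‖z‖ ^ 2) ^ α))

/-- The invariant measure `dτ = (1-|z|²)^{-(n+1)} dv` on the unit ball. -/
def measTau (n : ℕ) : Measure (En n) :=
  ((vol n).restrict (uball n)).withDensity
    (fun z => ENNReal.ofReal ((1 - ‖z‖ ^ 2) ^ (-((n : ℝ) + 1))))

/-- The Bergman space (quasi-)norm `‖f‖_{p,α}`, valued in `ℝ≥0∞`. -/
def apnorm (n : ℕ) (p α : ℝ) (f : En n → ℂ) : ℝ≥0∞ :=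
  (∫⁻ z, ENNReal.ofReal (‖f z‖ ^ p) ∂measA n α) ^ (1 / p)

/-- The radial derivative `Rf(z) = ∑ z_k ∂f/∂z_k = Df(z)[z]`. -/
def radD {n : ℕ} (f : En n → ℂ) (z : En n) : ℂ := fderiv ℂ f z z

/-- Iterated radial derivative `R^k f`. -/
def radIter {n : ℕ} : ℕ → (En n → ℂ) → En n → ℂ
  | 0, f => f
  | (k + 1), f => radD (radIter k f)

/-- The pseudo-metric `ϱ` on the unit ball. -/
def rho {n : ℕ} (z w : En n) : ℝ :=
  if z ≠ 0 ∧ w ≠ 0 then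
    |‖z‖ - ‖w‖| + ‖1 - herm z w / ((‖z‖ : ℂ) * (‖w‖ : ℂ))‖
  else ‖z‖ + ‖w‖

/-- The Bergman-ball maximal function `M_γ g(z) = sup_{w ∈ D(z,γ)} g(w)`, valued in `ℝ≥0∞`. -/
def maxF {n : ℕ} (γ : ℝ) (g : En n → ℝ) (z : En n) : ℝ≥0∞ :=
  ⨆ w ∈ Dball z γ, ENNReal.ofReal (g w)

/-- The smallest nonnegative integer `N` with `pN + α > -1`. -/
def Nmin (p α : ℝ) : ℕ := sInf {k : ℕ | p * k + α > -1}

/-- The norm of the generalized Bergman space `A^p_α`,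
`‖f‖_{p,α} = |f(0)| + (∫ (1-|z|²)^{pN} |R^N f|^p dv_α)^{1/p}` with `N = Nmin p α`. -/
def gapnorm (n : ℕ) (p α : ℝ) (f : En n → ℂ) : ℝ≥0∞ :=
  ENNReal.ofReal ‖f 0‖ +
    (∫⁻ z, ENNReal.ofReal ((1 - ‖z‖ ^ 2) ^ (p * Nmin p α) *
        ‖radIter (Nmin p α) f z‖ ^ p) ∂measA n α) ^ (1 / p)

def dd {n : ℕ} (z : En n) : ℝ := 1 - ‖z‖ ^ 2

lemma herm_eq {n : ℕ} (z w : En n) : herm z w = inner ℂ w z := by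
  simp [herm, PiLp.inner_apply]

lemma mem_ub {n : ℕ} {z : En n} : z ∈ uball n ↔ ‖z‖ < 1 := by simp [uball]

lemma mem_ub' {n : ℕ} {z : En n} : z ∈ uball n ↔ 0 < dd z := by
  rw [mem_ub, dd, sub_pos, sq_lt_one_iff₀ (norm_nonneg _)]

lemma dd_le_one {n : ℕ} (z : En n) : dd z ≤ 1 := by
  unfold dd; nlinarith [sq_nonneg ‖z‖]

def Near {n : ℕ} (K : ℝ) (z w : En n) : Prop :=
  ‖1 - herm z w‖ < K * dd z ∧ ‖1 - herm z w‖ < K * dd w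

lemma herm_comm_norm {n : ℕ} (z w : En n) : ‖1 - herm z w‖ = ‖1 - herm w z‖ := by
  rw [herm_eq, herm_eq, ← inner_conj_symm z w]
  rw [← Complex.norm_conj]; simp

lemma Near.symm {n : ℕ} {K : ℝ} {z w : En n} (h : Near K z w) : Near K w z := by
  unfold Near at *; rw [herm_comm_norm w z]; exact ⟨h.2, h.1⟩

lemma Near.mono {n : ℕ} {K K' : ℝ} {z w : En n} (h : Near K z w) (hK : K ≤ K')
    (hz : z ∈ uball n) (hw : w ∈ uball n) : Near K' z w := by
  rw [mem_ub'] at hz hw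
  exact ⟨h.1.trans_le (by gcongr), h.2.trans_le (by gcongr)⟩

lemma herm_norm_le {n : ℕ} (z w : En n) : ‖herm z w‖ ≤ ‖z‖ * ‖w‖ := by
  rw [herm_eq, mul_comm]; exact norm_inner_le_norm w z

lemma dd_le_two {n : ℕ} {z w : En n} (hz : z ∈ uball n) (hw : w ∈ uball n) :
    dd z ≤ 2 * ‖1 - herm z w‖ := by
  rw [mem_ub] at *
  have h1 : 1 - ‖z‖ * ‖w‖ ≤ ‖1 - herm z w‖ := by
    have := norm_sub_norm_le (1 : ℂ) (herm z w)
    have h2 := herm_norm_le z w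
    simp at this; linarith
  unfold dd
  nlinarith [norm_nonneg z, norm_nonneg w]

lemma Near.K_pos {n : ℕ} {K : ℝ} {z w : En n} (h : Near K z w)
    (hz : z ∈ uball n) : 0 < K := by
  rw [mem_ub'] at hz
  have := (norm_nonneg _).trans_lt h.1
  exact pos_of_mul_pos_left this hz.le

lemma Near.dd_le {n : ℕ} {K : ℝ} {z w : En n} (h : Near K z w)
    (hz : z ∈ uball n) (hw : w ∈ uball n) : dd z ≤ 2 * K * dd w := by
  have := dd_le_two hz hw
  linarith [h.2]

lemma mobius_id {n : ℕ} {z w : En n} (hz : z ∈ uball n) :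
    ‖1 - herm w z‖ ^ 2 - ‖z - prj z w - ((Real.sqrt (1 - ‖z‖ ^ 2) : ℝ) : ℂ) • (w - prj z w)‖ ^ 2
      = dd z * dd w := by
  have hs : Real.sqrt (1 - ‖z‖ ^ 2) ^ 2 = 1 - ‖z‖ ^ 2 :=
    Real.sq_sqrt (by rw [mem_ub'] at hz; exact hz.le)
  set s := Real.sqrt (1 - ‖z‖ ^ 2)
  by_cases h0 : z = 0
  · subst h0
    have hs1 : s = 1 := by simp [s]
    simp [prj, herm, hs1, dd]
  · have hz0 : ‖z‖ ^ 2 ≠ 0 := by positivity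
    set t := herm w z with ht
    have hzz : herm z z = ((‖z‖ ^ 2 : ℝ) : ℂ) := by
      rw [herm_eq, inner_self_eq_norm_sq_to_K]; simp
    have hP : prj z w = (t / ((‖z‖ ^ 2 : ℝ) : ℂ)) • z := by simp [prj, h0, hzz, ht]
    set q := t / ((‖z‖ ^ 2 : ℝ) : ℂ) with hq
    have htq : t = q * ((‖z‖ ^ 2 : ℝ) : ℂ) := by
      rw [hq, div_mul_cancel₀]; exact_mod_cast hz0
    have horth : inner ℂ z (w - q • z) = 0 := by
      rw [inner_sub_right, inner_smul_right, ← herm_eq, ← herm_eq, hzz, ← ht, htq]; ring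
    have e1 : z - prj z w - (s : ℂ) • (w - prj z w) = (1 - q) • z + (-(s : ℂ)) • (w - q • z) := by
      rw [hP]; module
    have e2 : ‖(1 - q) • z + (-(s : ℂ)) • (w - q • z)‖ ^ 2
        = ‖1 - q‖ ^ 2 * ‖z‖ ^ 2 + s ^ 2 * ‖w - q • z‖ ^ 2 := by
      have := norm_add_sq_eq_norm_sq_add_norm_sq_of_inner_eq_zero ((1 - q) • z)
        ((-(s : ℂ)) • (w - q • z)) (by rw [inner_smul_left, inner_smul_right, horth]; simp)
      rw [← sq, ← sq, ← sq] at this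
      rw [this, norm_smul, norm_smul, mul_pow, mul_pow, norm_neg, Complex.norm_real, Real.norm_eq_abs, sq_abs]
    have e3 : ‖w‖ ^ 2 = ‖w - q • z‖ ^ 2 + ‖q‖ ^ 2 * ‖z‖ ^ 2 := by
      have := norm_add_sq_eq_norm_sq_add_norm_sq_of_inner_eq_zero (q • z) (w - q • z)
        (by rw [inner_smul_left, horth]; simp)
      rw [← sq, ← sq, ← sq, norm_smul, mul_pow] at this
      simp at this
      linarith
    rw [e1, e2, hs]
    have e4 : ‖1 - t‖ ^ 2 = 1 - 2 * q.re * ‖z‖ ^ 2 + ‖q‖ ^ 2 * (‖z‖ ^ 2) ^ 2 := by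
      rw [htq, ← Complex.normSq_eq_norm_sq, ← Complex.normSq_eq_norm_sq, Complex.normSq_apply, Complex.normSq_apply]
      simp only [Complex.sub_re, Complex.sub_im, Complex.re_mul_ofReal, Complex.im_mul_ofReal, Complex.one_re, Complex.one_im]; ring
    have e5 : ‖1 - q‖ ^ 2 = 1 - 2 * q.re + ‖q‖ ^ 2 := by
      rw [← Complex.normSq_eq_norm_sq, ← Complex.normSq_eq_norm_sq, Complex.normSq_apply, Complex.normSq_apply]
      simp; ring
    rw [e4, e5]; unfold dd; rw [e3]; ring

lemma near_of_Dball {n : ℕ} {γ : ℝ} {z w : En n} (hz : z ∈ uball n) (h : w ∈ Dball z γ) :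
    Near (2 * Real.exp (2 * γ)) z w := by
  obtain ⟨hw, hb⟩ := h
  have hid := mobius_id (w := w) hz
  have hz' := mem_ub'.1 hz
  have hw' := mem_ub'.1 hw
  have h1 := dd_le_two hz hw
  have h2 := dd_le_two hw hz
  rw [herm_comm_norm z w] at h1
  set Y := ‖1 - herm w z‖ with hY
  have hYp : 0 < Y := by linarith
  set N := ‖z - prj z w - ((Real.sqrt (1 - ‖z‖ ^ 2) : ℝ) : ℂ) • (w - prj z w)‖ with hN
  have hm : ‖mobius z w‖ = N / Y := by
    rw [mobius, norm_smul, ← hN, norm_div, ← hY]; simp; ring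
  have hN0 : 0 ≤ N := norm_nonneg _
  have hNY : N < Y := by
    have : 0 < dd z * dd w := by positivity
    nlinarith
  unfold bmet at hb
  rw [hm] at hb
  have hm1 : (1 + N / Y) / (1 - N / Y) = (Y + N) / (Y - N) := by
    have : Y - N ≠ 0 := by linarith
    field_simp
  rw [hm1] at hb
  have hlog : Real.log ((Y + N) / (Y - N)) < 2 * γ := by linarith
  have hpos : 0 < (Y + N) / (Y - N) := by
    apply div_pos <;> linarith
  rw [Real.log_lt_iff_lt_exp hpos, div_lt_iff₀ (by linarith)] at hlog
  have he : 0 < Real.exp (2 * γ) := Real.exp_pos _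
  have key : Y ^ 2 < Real.exp (2 * γ) * (dd z * dd w) := by
    rw [← hid]
    have : (Y + N) * (Y + N) < (Real.exp (2 * γ) * (Y - N)) * (Y + N) := by
      apply mul_lt_mul_of_pos_right hlog; linarith
    nlinarith
  have k1 : Y * Y < (2 * Real.exp (2 * γ) * dd z) * Y := by
    have : Real.exp (2 * γ) * (dd z * dd w) ≤ Real.exp (2 * γ) * (dd z * (2 * Y)) := by gcongr
    nlinarith
  have k2 : Y * Y < (2 * Real.exp (2 * γ) * dd w) * Y := by
    have : Real.exp (2 * γ) * (dd z * dd w) ≤ Real.exp (2 * γ) * ((2 * Y) * dd w) := by gcongr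
    nlinarith
  constructor <;> rw [herm_comm_norm z w]
  · exact lt_of_mul_lt_mul_right k1 hYp.le
  · exact lt_of_mul_lt_mul_right k2 hYp.le

lemma self_mem_Dball {n : ℕ} {γ : ℝ} (hγ : 0 < γ) {z : En n} (hz : z ∈ uball n) : z ∈ Dball z γ := by
  refine ⟨hz, ?_⟩
  have : mobius z z = 0 := by
    by_cases h0 : z = 0
    · subst h0; simp [mobius, prj]
    · have : herm z z ≠ 0 := by
        rw [herm_eq]; simpa using h0
      simp [mobius, prj, h0, div_self this]
  simp [bmet, this, hγ]

def sw {n : ℕ} (w : En n) : ℝ := Real.sqrt (dd w)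

lemma sw_sq {n : ℕ} {w : En n} (hw : w ∈ uball n) : sw w ^ 2 = dd w :=
  Real.sq_sqrt (mem_ub'.1 hw).le

lemma sw_pos {n : ℕ} {w : En n} (hw : w ∈ uball n) : 0 < sw w :=
  Real.sqrt_pos.2 (mem_ub'.1 hw)

/-- the anisotropic dilation `s^2 P_w + s Q_w`. -/
def Lm {n : ℕ} (w : En n) : En n →ₗ[ℂ] En n :=
  ((sw w : ℝ) : ℂ) • LinearMap.transvection
    ((-(1 / (1 + sw w) : ℝ) : ℂ) • (innerSL ℂ w).toLinearMap) w

lemma Lm_apply {n : ℕ} (w v : En n) :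
    Lm w v = ((sw w : ℝ) : ℂ) • (v - (((1 / (1 + sw w) : ℝ) : ℂ) * inner ℂ w v) • w) := by
  simp [Lm, LinearMap.transvection, sub_eq_add_neg]

lemma inner_self_C {n : ℕ} (w : En n) : inner ℂ w w = ((1 - dd w : ℝ) : ℂ) := by
  rw [inner_self_eq_norm_sq_to_K]; simp [dd]

lemma one_sub_C {n : ℕ} {w : En n} (hw : w ∈ uball n) :
    (1 : ℂ) - ((1 / (1 + sw w) : ℝ) : ℂ) * inner ℂ w w = ((sw w : ℝ) : ℂ) := by
  rw [inner_self_C, ← sw_sq hw, ← Complex.ofReal_one, ← Complex.ofReal_mul, ← Complex.ofReal_sub]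
  congr 1
  have := sw_pos hw
  field_simp; ring

lemma Lm_det {n : ℕ} {w : En n} (hw : w ∈ uball n) :
    |LinearMap.det ((Lm w).restrictScalars ℝ)| = dd w ^ (n + 1) := by
  have h1 : LinearMap.det (Lm w) = ((sw w : ℝ) : ℂ) ^ (n + 1) := by
    rw [Lm, LinearMap.det_smul, LinearMap.transvection.det]
    have := one_sub_C hw
    simp only [LinearMap.smul_apply, smul_eq_mul]
    rw [finrank_euclideanSpace_fin, pow_succ, ← this]
    congr 1
    simp [sub_eq_add_neg]
  have h2 : LinearMap.det ((Lm w).restrictScalars ℝ) = Algebra.norm ℝ (LinearMap.det (Lm w)) :=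
    LinearMap.det_restrictScalars
  rw [h2, h1, Algebra.norm_complex_apply, Complex.normSq_eq_norm_sq, norm_pow, Complex.norm_real]
  have := sw_pos hw
  rw [Real.norm_of_nonneg this.le, ← sw_sq hw, abs_of_pos (by positivity)]
  ring

lemma inner_Lm {n : ℕ} {w : En n} (hw : w ∈ uball n) (v : En n) :
    inner ℂ w (Lm w v) = ((dd w : ℝ) : ℂ) * inner ℂ w v := by
  rw [Lm_apply, inner_smul_right, inner_sub_right, inner_smul_right, ← sw_sq hw]
  have := one_sub_C hw
  push_cast at *
  linear_combination ((sw w : ℝ) : ℂ) * inner ℂ w v * this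

lemma Lm_adj {n : ℕ} (w z v : En n) : inner ℂ z (Lm w v) = inner ℂ (Lm w z) v := by
  rw [Lm_apply, Lm_apply, inner_smul_right, inner_smul_left, inner_sub_right, inner_sub_left,
    inner_smul_right, inner_smul_left]
  simp only [map_mul, Complex.conj_ofReal, inner_conj_symm]
  ring

lemma norm_sub_smul_sq {n : ℕ} (w v : En n) (c : ℝ) :
    ‖v - ((c : ℂ) * inner ℂ w v) • w‖ ^ 2
      = ‖v‖ ^ 2 - (2 * c - c ^ 2 * ‖w‖ ^ 2) * ‖(inner ℂ w v : ℂ)‖ ^ 2 := by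
  rw [@norm_sub_sq ℂ, norm_smul, inner_smul_right, norm_mul, Complex.norm_real, Real.norm_eq_abs]
  have h : (inner ℂ w v : ℂ) * inner ℂ v w = ((‖(inner ℂ w v : ℂ)‖ ^ 2 : ℝ) : ℂ) := by
    rw [← inner_conj_symm v w, Complex.mul_conj, Complex.normSq_eq_norm_sq]
  rw [mul_assoc, h, ← Complex.ofReal_mul]
  have h2 : ∀ x : ℝ, RCLike.re (x : ℂ) = x := fun x => Complex.ofReal_re x
  rw [h2, mul_pow, mul_pow, sq_abs]
  ring

lemma Lm_norm_sq {n : ℕ} {w : En n} (hw : w ∈ uball n) (v : En n) :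
    ‖Lm w v‖ ^ 2 = dd w * (‖v‖ ^ 2 - ‖(inner ℂ w v : ℂ)‖ ^ 2) := by
  rw [Lm_apply, norm_smul, mul_pow, norm_sub_smul_sq, Complex.norm_real, Real.norm_eq_abs, sq_abs, sw_sq hw]
  have h1 : ‖w‖ ^ 2 = 1 - sw w ^ 2 := by rw [sw_sq hw]; unfold dd; ring
  have := sw_pos hw
  rw [h1]
  congr 2
  field_simp; ring

def Li {n : ℕ} (w x : En n) : En n :=
  (((sw w)⁻¹ : ℝ) : ℂ) • (x - (((-(1 / (sw w * (1 + sw w))) : ℝ) : ℂ) * inner ℂ w x) • w)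

lemma Li_norm_sq {n : ℕ} {w : En n} (hw : w ∈ uball n) (x : En n) :
    ‖Li w x‖ ^ 2 = ‖x‖ ^ 2 / dd w + ‖(inner ℂ w x : ℂ)‖ ^ 2 / dd w ^ 2 := by
  rw [Li, norm_smul, mul_pow, norm_sub_smul_sq, Complex.norm_real, Real.norm_eq_abs, sq_abs, inv_pow]
  have h1 : ‖w‖ ^ 2 = 1 - sw w ^ 2 := by rw [sw_sq hw]; unfold dd; ring
  have := sw_pos hw
  rw [h1, ← sw_sq hw]
  field_simp; ring

lemma Lm_Li {n : ℕ} {w : En n} (hw : w ∈ uball n) (x : En n) : Lm w (Li w x) = x := by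
  have hs := sw_pos hw
  have hs' : ((sw w : ℝ) : ℂ) ≠ 0 := by exact_mod_cast hs.ne'
  have hs1 : (1 + (sw w : ℝ) : ℂ) ≠ 0 := by exact_mod_cast (by positivity : 1 + sw w ≠ 0)
  have h3 := inner_self_C w
  rw [← sw_sq hw] at h3
  rw [Li, map_smul, Lm_apply, inner_sub_right, inner_smul_right, h3, smul_smul, smul_sub, smul_sub, smul_smul, smul_smul]
  rw [← Complex.ofReal_mul, inv_mul_cancel₀ hs.ne', Complex.ofReal_one, one_smul, sub_sub, ← add_smul]
  convert sub_zero x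
  convert zero_smul ℂ w
  push_cast
  field_simp
  ring

instance (n : ℕ) : (vol n).IsAddHaarMeasure := by unfold vol; infer_instance

lemma holo_radD {n : ℕ} {g : En n → ℂ} (hg : DifferentiableOn ℂ g (uball n)) :
    DifferentiableOn ℂ (radD g) (uball n) := by
  intro z₀ hz₀
  apply DifferentiableAt.differentiableWithinAt
  have hr := mem_ub.1 hz₀
  set e := (1 - ‖z₀‖) / 8 with he
  have hopen : IsOpen (uball n) := Metric.isOpen_ball
  have he0 : 0 < e := by rw [he]; linarith
  have hr0 := norm_nonneg z₀
  have hmul : ∀ z ∈ Metric.ball z₀ e, ∀ l : ℂ, ‖l - 1‖ ≤ e → ‖l • z‖ ≤ ‖z₀‖ + 3 * e := by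
    intro z hz l hl
    have h1 : ‖z‖ ≤ ‖z₀‖ + e := by
      have := norm_sub_norm_le z z₀
      rw [mem_ball_iff_norm] at hz; linarith
    have h2 : ‖l‖ ≤ 1 + e := by
      have := norm_sub_norm_le l 1
      simp at this; linarith
    rw [norm_smul]
    have : ‖l‖ * ‖z‖ ≤ (1 + e) * (‖z₀‖ + e) := by gcongr
    nlinarith
  obtain ⟨M, hM⟩ : ∃ M, ∀ x ∈ Metric.closedBall (0 : En n) (‖z₀‖ + 4 * e), ‖g x‖ ≤ M := by
    apply (isCompact_closedBall _ _).exists_bound_of_continuousOn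
    apply hg.continuousOn.mono
    intro x hx
    rw [mem_closedBall_zero_iff] at hx
    rw [mem_ub]; linarith
  have hfd : ∀ x : En n, ‖x‖ ≤ ‖z₀‖ + 3 * e → ‖fderiv ℂ g x‖ ≤ (2 * M) / e := by
    intro x hx
    have hsub : ∀ y ∈ Metric.ball x e, ‖y‖ ≤ ‖z₀‖ + 4 * e := by
      intro y hy
      have := norm_sub_norm_le y x
      rw [mem_ball_iff_norm] at hy; linarith
    apply Complex.norm_fderiv_le_div_of_mapsTo_ball _ _ he0
    · apply hg.mono
      intro y hy
      have := hsub y hy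
      rw [mem_ub]; linarith
    · intro y hy
      rw [mem_closedBall_iff_norm]
      have h1 := hM y (by simpa using hsub y hy)
      have h2 := hM x (by simpa using hsub x (Metric.mem_ball_self he0))
      have := norm_sub_le (g y) (g x)
      linarith
  have hin : ∀ z ∈ Metric.ball z₀ e, ∀ l : ℂ, ‖l - 1‖ ≤ e → l • z ∈ uball n := by
    intro z hz l hl
    have := hmul z hz l hl
    rw [mem_ub]; linarith
  have hform : ∀ z ∈ Metric.ball z₀ e, radD g z =
      (2 * Real.pi * Complex.I : ℂ)⁻¹ • ∮ l in C(1, e), ((l - 1) ^ 2)⁻¹ • g (l • z) := by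
    intro z hz
    have hU : IsOpen {l : ℂ | l • z ∈ uball n} := by
      apply hopen.preimage; fun_prop
    have hd : DifferentiableOn ℂ (fun l : ℂ => g (l • z)) {l : ℂ | l • z ∈ uball n} := by
      apply hg.comp (t := uball n) (f := fun l : ℂ => l • z)
      · fun_prop
      · intro l hl; exact hl
    have := Complex.two_pi_I_inv_smul_circleIntegral_sub_sq_inv_smul_of_differentiable
      (c := 1) (w₀ := 1) (R := e) hU
      (by intro l hl; rw [mem_closedBall_iff_norm] at hl; exact hin z hz l hl) hd (Metric.mem_ball_self he0)
    rw [this, radD]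
    have h1 : HasFDerivAt g (fderiv ℂ g ((1 : ℂ) • z)) ((1 : ℂ) • z) :=
      (hg.differentiableAt (hopen.mem_nhds (hin z hz 1 (by simpa using he0.le)))).hasFDerivAt
    have h2 : HasDerivAt (fun l : ℂ => l • z) ((1 : ℂ) • z) 1 := by
      simpa using (hasDerivAt_id (1 : ℂ)).smul_const z
    have := (h1.comp_hasDerivAt (1 : ℂ) h2).deriv
    rw [one_smul] at this
    exact this.symm
  have hev : radD g =ᶠ[𝓝 z₀] fun z => (2 * Real.pi * Complex.I : ℂ)⁻¹ •
      ∮ l in C(1, e), ((l - 1) ^ 2)⁻¹ • g (l • z) := by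
    filter_upwards [Metric.ball_mem_nhds z₀ he0] with z hz using hform z hz
  refine DifferentiableAt.congr_of_eventuallyEq ?_ hev
  apply DifferentiableAt.fun_const_smul
  simp only [circleIntegral]
  set cm := circleMap (1 : ℂ) e with hcm
  have hcmn : ∀ θ, ‖cm θ - 1‖ = e := by
    intro θ; simp [hcm, circleMap, abs_of_pos he0]
  have hcmc : Continuous cm := continuous_circleMap 1 e
  have hdcm : Continuous (deriv cm) := by
    have : deriv cm = fun θ => circleMap 0 e θ * Complex.I := by
      ext θ; simp [hcm]
    rw [this]; exact (continuous_circleMap 0 e).mul continuous_const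
  have hdn : ∀ θ, ‖deriv cm θ‖ = e := by
    intro θ; simp [hcm, circleMap, abs_of_pos he0]
  have hcont : ∀ z ∈ Metric.ball z₀ e, Continuous
      (fun θ : ℝ => deriv cm θ • ((cm θ - 1) ^ 2)⁻¹ • g (cm θ • z)) := by
    intro z hz
    apply hdcm.smul
    refine Continuous.smul (f := fun θ => ((cm θ - 1) ^ 2)⁻¹) (g := fun θ => g (cm θ • z)) ?_ ?_
    · apply Continuous.inv₀ (by fun_prop)
      intro θ h
      have := hcmn θ
      rw [pow_eq_zero_iff two_ne_zero] at h
      rw [h] at this; simp at this; linarith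
    · apply hg.continuousOn.comp_continuous (by fun_prop)
      intro θ; exact hin z hz _ (hcmn θ).le
  have main := intervalIntegral.hasFDerivAt_integral_of_dominated_of_fderiv_le (𝕜 := ℂ)
    (μ := volume) (a := 0) (b := 2 * Real.pi) (x₀ := z₀) (s := Metric.ball z₀ e)
    (F := fun (z : En n) (θ : ℝ) => deriv cm θ • ((cm θ - 1) ^ 2)⁻¹ • g (cm θ • z))
    (F' := fun (z : En n) (θ : ℝ) => deriv cm θ • ((cm θ - 1) ^ 2)⁻¹ • cm θ • fderiv ℂ g (cm θ • z))
    (bound := fun _ => e * ((e ^ 2)⁻¹ * ((1 + e) * (2 * M / e))))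
    (Metric.ball_mem_nhds z₀ he0) ?_ ?_ ?_ ?_ ?_ ?_
  · exact main.differentiableAt
  · filter_upwards [Metric.ball_mem_nhds z₀ he0] with z hz
    exact (hcont z hz).aestronglyMeasurable
  · exact (hcont z₀ (Metric.mem_ball_self he0)).intervalIntegrable _ _
  · apply Measurable.aestronglyMeasurable
    have h1 : Measurable fun θ : ℝ => fderiv ℂ g (cm θ • z₀) :=
      (measurable_fderiv ℂ g).comp (by fun_prop : Continuous fun θ : ℝ => cm θ • z₀).measurable
    have := hdcm.measurable
    have := hcmc.measurable
    fun_prop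
  · refine Eventually.of_forall fun θ _ z hz => ?_
    rw [norm_smul, norm_smul, norm_smul, hdn, norm_inv, norm_pow, hcmn]
    have h1 := hfd _ (hmul z hz _ (hcmn θ).le)
    have h2 : ‖cm θ‖ ≤ 1 + e := by
      have := norm_sub_norm_le (cm θ) 1
      rw [hcmn] at this
      simp at this; linarith
    gcongr
  · exact intervalIntegrable_const
  · refine Eventually.of_forall fun θ _ z hz => ?_
    apply HasFDerivAt.fun_const_smul
    apply HasFDerivAt.fun_const_smul
    have h1 : HasFDerivAt g (fderiv ℂ g (cm θ • z)) (cm θ • z) :=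
      (hg.differentiableAt (hopen.mem_nhds (hin z hz _ (hcmn θ).le))).hasFDerivAt
    have h2 : HasFDerivAt (fun z : En n => cm θ • z) (cm θ • ContinuousLinearMap.id ℂ (En n)) z :=
      (hasFDerivAt_id z).const_smul (cm θ)
    have := h1.comp z h2
    simpa [Function.comp_def] using this
  
lemma holo_radIter {n : ℕ} {f : En n → ℂ} (hf : DifferentiableOn ℂ f (uball n)) (k : ℕ) :
    DifferentiableOn ℂ (radIter k f) (uball n) := by
  induction k with
  | zero => exact hf
  | succ k ih => exact holo_radD ih

lemma radIter_zero {n : ℕ} (f : En n → ℂ) (k : ℕ) : radIter (k + 1) f 0 = 0 := by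
  simp [radIter, radD]

lemma smv_real {n : ℕ} {N : ℝ} (hN : 0 < N) {h : En n → ℂ}
    (hh : DifferentiableOn ℂ h (Metric.ball 0 2)) (h0 : h 0 ≠ 0) :
    ∃ z₀ : En n, ∃ δ : ℝ, 0 < δ ∧ 2 * δ ≤ 1 ∧ ‖h 0‖ ≤ (2 * δ) ^ N * ‖h z₀‖ ∧
      Metric.ball z₀ ((1 / (2 * (2 ^ N + 1))) * δ) ⊆ Metric.ball 0 1 ∧
      ∀ z ∈ Metric.ball z₀ ((1 / (2 * (2 ^ N + 1))) * δ), ‖h z₀‖ / 2 ≤ ‖h z‖ := by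
  have hc : ContinuousOn (fun z => (1 - ‖z‖) ^ N * ‖h z‖) (Metric.closedBall (0 : En n) 1) := by
    apply ContinuousOn.mul
    · apply Continuous.continuousOn
      exact Continuous.rpow_const (by fun_prop) (fun _ => Or.inr hN.le)
    · exact (hh.continuousOn.mono (Metric.closedBall_subset_ball (by norm_num))).norm
  obtain ⟨z₀, hz₀, hmax⟩ := (isCompact_closedBall (0 : En n) 1).exists_isMaxOn
    ⟨0, by simp⟩ hc
  rw [mem_closedBall_zero_iff] at hz₀
  have hm0 : ‖h 0‖ ≤ (1 - ‖z₀‖) ^ N * ‖h z₀‖ := by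
    have := hmax (show (0 : En n) ∈ Metric.closedBall 0 1 by simp)
    simpa using this
  have hlt : ‖z₀‖ < 1 := by
    rcases hz₀.lt_or_eq with h1 | h1
    · exact h1
    · rw [h1, sub_self, Real.zero_rpow hN.ne', zero_mul] at hm0
      exact absurd (norm_le_zero_iff.1 hm0) h0
  set δ := (1 - ‖z₀‖) / 2 with hδ
  have h2δ : 1 - ‖z₀‖ = 2 * δ := by rw [hδ]; ring
  have hδ0 : 0 < δ := by rw [hδ]; linarith
  rw [h2δ] at hm0
  have hpos : (0 : ℝ) < 2 ^ N := by positivity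
  have hsub : ∀ z ∈ Metric.ball z₀ δ, ‖z‖ ≤ 1 - δ := by
    intro z hz
    have := norm_sub_norm_le z z₀
    rw [mem_ball_iff_norm] at hz; linarith
  have hbd : ∀ z ∈ Metric.ball z₀ δ, ‖h z‖ ≤ 2 ^ N * ‖h z₀‖ := by
    intro z hz
    have h1 := hsub z hz
    have h2 := hmax (show z ∈ Metric.closedBall 0 1 by rw [mem_closedBall_zero_iff]; linarith)
    simp only [Set.mem_ofPred_eq] at h2
    rw [h2δ, Real.mul_rpow (by norm_num) hδ0.le] at h2
    have h3 : δ ^ N ≤ (1 - ‖z‖) ^ N := Real.rpow_le_rpow hδ0.le (by linarith) hN.le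
    have h4 : δ ^ N * ‖h z‖ ≤ (1 - ‖z‖) ^ N * ‖h z‖ := by gcongr
    have h5 : 0 < δ ^ N := by positivity
    have : δ ^ N * ‖h z‖ ≤ δ ^ N * (2 ^ N * ‖h z₀‖) := by linarith
    exact le_of_mul_le_mul_left this h5
  have hcl : 1 / (2 * ((2 : ℝ) ^ N + 1)) * δ ≤ δ := by
    apply mul_le_of_le_one_left hδ0.le
    rw [div_le_one (by positivity)]; linarith
  refine ⟨z₀, δ, hδ0, by linarith [norm_nonneg z₀], hm0, ?_, ?_⟩
  · intro z hz
    have := hsub z (Metric.ball_subset_ball hcl hz)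
    rw [mem_ball_zero_iff]; linarith
  · intro z hz
    have h1 := Complex.dist_le_div_mul_dist_of_mapsTo_ball (f := h) (c := z₀) (R₁ := δ)
      (R₂ := (2 ^ N + 1) * ‖h z₀‖) (z := z)
      (hh.mono (by
        intro y hy
        have := hsub y hy
        rw [mem_ball_zero_iff]; linarith))
      (by
        intro y hy
        rw [mem_closedBall_iff_norm]
        have := norm_sub_le (h y) (h z₀)
        have := hbd y hy
        linarith)
      (Metric.ball_subset_ball hcl hz)
    rw [Metric.mem_ball] at hz
    have h2 : (2 ^ N + 1) * ‖h z₀‖ / δ * dist z z₀ ≤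
        (2 ^ N + 1) * ‖h z₀‖ / δ * (1 / (2 * ((2 : ℝ) ^ N + 1)) * δ) := by gcongr
    have h3 : (2 ^ N + 1) * ‖h z₀‖ / δ * (1 / (2 * ((2 : ℝ) ^ N + 1)) * δ) = ‖h z₀‖ / 2 := by
      field_simp
    rw [dist_eq_norm] at h1
    have := norm_sub_norm_le (h z₀) (h z)
    rw [norm_sub_rev] at this
    linarith

lemma smv (n : ℕ) {p : ℝ} (hp : 0 < p) : ∃ C : ℝ≥0∞, C ≠ ⊤ ∧ ∀ h : En n → ℂ,
    DifferentiableOn ℂ h (Metric.ball 0 2) →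
    ‖h 0‖ₑ ^ p ≤ C * ∫⁻ v in Metric.ball 0 1, ‖h v‖ₑ ^ p ∂vol n := by
  set q := Module.finrank ℝ (En n) with hq
  set N : ℝ := (q + 1) / p with hN
  have hN0 : 0 < N := by positivity
  set c : ℝ := 1 / (2 * (2 ^ N + 1)) with hc
  have hc0 : 0 < c := by positivity
  set V := vol n (Metric.ball 0 1) with hV
  have hV0 : V ≠ 0 := (Metric.measure_ball_pos _ _ one_pos).ne'
  have hVt : V ≠ ⊤ := measure_ball_lt_top.ne
  refine ⟨ENNReal.ofReal (2 ^ p * (2 / c) ^ q) * V⁻¹, ENNReal.mul_ne_top (by simp) (by simp [hV0]), ?_⟩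
  intro h hh
  by_cases h0 : h 0 = 0
  · simp [h0, hp]
  obtain ⟨z₀, δ, hδ, hδ1, hle, hsub, hlow⟩ := smv_real hN0 hh h0
  rw [← hc] at hsub hlow
  set A := ‖h z₀‖ with hA
  have hA0 : 0 ≤ A := norm_nonneg _
  have e1 : ENNReal.ofReal ((A / 2) ^ p) * (ENNReal.ofReal ((c * δ) ^ q) * V)
      ≤ ∫⁻ v in Metric.ball 0 1, ‖h v‖ₑ ^ p ∂vol n := by
    rw [hV, hq, ← Measure.addHaar_ball_of_pos (vol n) z₀ (by positivity)]
    calc _ = ∫⁻ v in Metric.ball z₀ (c * δ), ENNReal.ofReal ((A / 2) ^ p) ∂vol n := by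
          rw [setLIntegral_const]
      _ ≤ ∫⁻ v in Metric.ball z₀ (c * δ), ‖h v‖ₑ ^ p ∂vol n := by
          apply setLIntegral_mono' measurableSet_ball
          intro v hv
          rw [← ENNReal.ofReal_rpow_of_nonneg (by positivity) hp.le, ← ofReal_norm]
          gcongr
          exact hlow v hv
      _ ≤ _ := lintegral_mono_set hsub
  have e2 : ‖h 0‖ₑ ^ p ≤ ENNReal.ofReal (2 ^ p * (2 / c) ^ q) *
      (ENNReal.ofReal ((A / 2) ^ p) * ENNReal.ofReal ((c * δ) ^ q)) := by
    rw [← ofReal_norm, ENNReal.ofReal_rpow_of_nonneg (norm_nonneg _) hp.le,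
      ← ENNReal.ofReal_mul (by positivity), ← ENNReal.ofReal_mul (by positivity)]
    apply ENNReal.ofReal_le_ofReal
    calc ‖h 0‖ ^ p ≤ ((2 * δ) ^ N * A) ^ p := by gcongr
      _ = (2 * δ) ^ (q + 1) * A ^ p := by
        rw [Real.mul_rpow (by positivity) hA0, ← Real.rpow_mul (by positivity), hN,
          div_mul_cancel₀ _ hp.ne', ← Real.rpow_natCast]; push_cast; rfl
      _ ≤ (2 * δ) ^ q * A ^ p := by
        gcongr ?_ * _
        exact pow_le_pow_of_le_one (by positivity) hδ1 (by simp)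
      _ = _ := by
        rw [Real.div_rpow hA0 (by norm_num), div_pow, mul_pow, mul_pow]
        field_simp
  calc _ ≤ _ := e2
    _ = ENNReal.ofReal (2 ^ p * (2 / c) ^ q) * V⁻¹ *
      (ENNReal.ofReal ((A / 2) ^ p) * (ENNReal.ofReal ((c * δ) ^ q) * V)) := by
        have : V⁻¹ * V = 1 := ENNReal.inv_mul_cancel hV0 hVt
        calc _ = ENNReal.ofReal (2 ^ p * (2 / c) ^ q) *
              (ENNReal.ofReal ((A / 2) ^ p) * ENNReal.ofReal ((c * δ) ^ q)) * (V⁻¹ * V) := by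
                rw [this, mul_one]
          _ = _ := by ring
    _ ≤ _ := by gcongr

lemma dd_add_Lm {n : ℕ} {w u : En n} (hw : w ∈ uball n) (hu : ‖u‖ ≤ 1 / 8) :
    dd w / 2 ≤ dd (w + Lm w u) := by
  have h1 := Lm_norm_sq hw u
  have h2 := inner_Lm hw u
  have hd := mem_ub'.1 hw
  have hw1 := mem_ub.1 hw
  have h3 : ‖(inner ℂ w u : ℂ)‖ ≤ 1 / 8 := by
    calc _ ≤ ‖w‖ * ‖u‖ := norm_inner_le_norm w u
      _ ≤ 1 * (1 / 8) := by gcongr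
      _ = _ := by norm_num
  have h4 : ‖w + Lm w u‖ ^ 2 = ‖w‖ ^ 2 + 2 * (dd w * (inner ℂ w u : ℂ).re) + ‖Lm w u‖ ^ 2 := by
    rw [@norm_add_sq ℂ, h2]
    have : RCLike.re ((dd w : ℂ) * inner ℂ w u) = dd w * (inner ℂ w u : ℂ).re := Complex.re_ofReal_mul _ _
    rw [this]
  have h5 : (inner ℂ w u : ℂ).re ≤ 1 / 8 := (Complex.re_le_norm _).trans h3
  have h6 : ‖u‖ ^ 2 ≤ 1 / 64 := by nlinarith [norm_nonneg u]
  have h7 : ‖Lm w u‖ ^ 2 ≤ dd w * (1 / 64) := by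
    rw [h1]; gcongr; nlinarith [sq_nonneg ‖(inner ℂ w u : ℂ)‖]
  have h8 : dd w * (inner ℂ w u : ℂ).re ≤ dd w * (1 / 8) := by gcongr
  have h9 : dd (w + Lm w u) = dd w - 2 * (dd w * (inner ℂ w u : ℂ).re) - ‖Lm w u‖ ^ 2 := by
    unfold dd at *; rw [h4]; ring
  rw [h9]; linarith

lemma near_add_Lm {n : ℕ} {K : ℝ} {z w u : En n} (hz : z ∈ uball n) (hw : w ∈ uball n)
    (h : Near K z w) (hu : ‖u‖ ≤ 1 / 8) :
    Near ((K + Real.sqrt (2 * K)) * (2 + 2 * K)) z (w + Lm w u) := by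
  have hK := h.K_pos hz
  have hd := mem_ub'.1 hw
  have h1 := dd_add_Lm hw hu
  have h2 : ‖herm z (Lm w u)‖ ≤ Real.sqrt (2 * K) * dd w := by
    rw [herm_eq, ← Lm_adj]
    have h3 : ‖Lm w z‖ ≤ Real.sqrt (2 * K) * dd w := by
      apply abs_le_of_sq_le_sq' _ (by positivity) |>.2
      rw [Lm_norm_sq hw, mul_pow, Real.sq_sqrt (by positivity), ← herm_eq]
      have h4 : 1 - ‖1 - herm z w‖ ≤ ‖herm z w‖ := by
        have := norm_sub_norm_le 1 (1 - herm z w)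
        simp at this; simpa using this
      have h5 := mem_ub.1 hz
      have h6 := h.2
      have h7 : ‖z‖ ^ 2 - ‖herm z w‖ ^ 2 ≤ 2 * K * dd w := by
        have a1 : ‖z‖ ^ 2 ≤ 1 := by nlinarith [norm_nonneg z]
        by_cases hc : ‖1 - herm z w‖ ≤ 1
        · have := pow_le_pow_left₀ (by linarith) h4 2
          nlinarith [sq_nonneg ‖1 - herm z w‖]
        · nlinarith [sq_nonneg ‖herm z w‖]
      nlinarith
    calc _ ≤ ‖u‖ * ‖Lm w z‖ := norm_inner_le_norm u _
      _ ≤ 1 * (Real.sqrt (2 * K) * dd w) := by gcongr; linarith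
      _ = _ := one_mul _
  have h3 : herm z (w + Lm w u) = herm z w + herm z (Lm w u) := by
    simp only [herm_eq, inner_add_left]
  have h4 : ‖1 - herm z (w + Lm w u)‖ < (K + Real.sqrt (2 * K)) * dd w := by
    rw [h3, ← sub_sub]
    have := norm_sub_le (1 - herm z w) (herm z (Lm w u))
    linarith [h.2]
  have h5 := h.symm.dd_le hw hz
  have hz' := mem_ub'.1 hz
  have hs : 0 ≤ Real.sqrt (2 * K) := Real.sqrt_nonneg _
  constructor
  · apply h4.trans_le
    rw [mul_assoc]; gcongr; nlinarith
  · apply h4.trans_le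
    rw [mul_assoc]; gcongr; nlinarith

lemma Li_bound {n : ℕ} {K : ℝ} {z w : En n} (hz : z ∈ uball n) (hw : w ∈ uball n)
    (h : Near K z w) : ‖Li w (z - w)‖ < 2 * K + 2 := by
  have hK := h.K_pos hz
  have hd := mem_ub'.1 hw
  apply lt_of_pow_lt_pow_left₀ 2 (by positivity)
  rw [Li_norm_sq hw]
  have h1 : ‖(inner ℂ w (z - w) : ℂ)‖ ≤ (K + 1) * dd w := by
    have : (inner ℂ w (z - w) : ℂ) = ((dd w : ℝ) : ℂ) - (1 - herm z w) := by
      rw [inner_sub_right, inner_self_C, herm_eq]; push_cast; ring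
    rw [this]
    have h2 := norm_sub_le ((dd w : ℝ) : ℂ) (1 - herm z w)
    rw [Complex.norm_real, Real.norm_of_nonneg hd.le] at h2
    linarith [h.2]
  have h2 : ‖z - w‖ ^ 2 ≤ 2 * K * dd w := by
    rw [@norm_sub_sq ℂ]
    have a1 : ‖z‖ ^ 2 ≤ 1 := by have := mem_ub.1 hz; nlinarith [norm_nonneg z]
    have a2 : ‖w‖ ^ 2 ≤ 1 := by have := mem_ub.1 hw; nlinarith [norm_nonneg w]
    have a3 : 1 - RCLike.re (inner ℂ z w : ℂ) ≤ ‖1 - herm z w‖ := by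
      rw [herm_comm_norm, herm_eq]
      have := Complex.re_le_norm (1 - inner ℂ z w)
      simpa using this
    linarith [h.2]
  have h3 : ‖z - w‖ ^ 2 / dd w ≤ 2 * K := by rw [div_le_iff₀ hd]; exact h2
  have h4 : ‖(inner ℂ w (z - w) : ℂ)‖ ^ 2 / dd w ^ 2 ≤ (K + 1) ^ 2 := by
    rw [div_le_iff₀ (by positivity), ← mul_pow]; gcongr
  nlinarith

lemma vol_near (n : ℕ) (K : ℝ) : ∃ C : ℝ≥0∞, C ≠ ⊤ ∧ ∀ w ∈ uball n,
    vol n {z | z ∈ uball n ∧ Near K z w} ≤ C * ENNReal.ofReal (dd w ^ (n + 1)) := by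
  refine ⟨vol n (Metric.ball 0 (2 * K + 2)), measure_ball_lt_top.ne, fun w hw => ?_⟩
  have hsub : {z | z ∈ uball n ∧ Near K z w} ⊆
      (fun x => w + x) '' (((Lm w).restrictScalars ℝ) '' (Metric.ball 0 (2 * K + 2))) := by
    rintro z ⟨hz, hn⟩
    refine ⟨z - w, ⟨Li w (z - w), ?_, ?_⟩, ?_⟩
    · rw [mem_ball_zero_iff]; exact Li_bound hz hw hn
    · exact Lm_Li hw _
    · simp
  refine (measure_mono hsub).trans ?_
  rw [Set.image_add_left, measure_preimage_add, Measure.addHaar_image_linearMap, Lm_det hw, mul_comm]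

def Avg {n : ℕ} (K : ℝ) (F : En n → ℝ≥0∞) (z : En n) : ℝ≥0∞ :=
  ENNReal.ofReal (dd z ^ (-((n : ℝ) + 1))) * ∫⁻ ξ in {ξ | ξ ∈ uball n ∧ Near K z ξ}, F ξ ∂vol n

lemma continuous_dd {n : ℕ} : Continuous (dd : En n → ℝ) := by unfold dd; fun_prop

lemma continuous_herm {n : ℕ} : Continuous (fun x : En n × En n => herm x.1 x.2) := by
  simp only [herm_eq]; fun_prop

lemma isOpen_Near {n : ℕ} (K : ℝ) : IsOpen {x : En n × En n | Near K x.1 x.2} := by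
  have h1 := continuous_herm (n := n)
  have h2 := continuous_dd (n := n)
  apply IsOpen.and
  · exact isOpen_lt (by fun_prop) (by fun_prop)
  · exact isOpen_lt (by fun_prop) (by fun_prop)

lemma isOpen_ub {n : ℕ} : IsOpen (uball n) := Metric.isOpen_ball

lemma meas_S {n : ℕ} (K : ℝ) (z : En n) : MeasurableSet {ξ | ξ ∈ uball n ∧ Near K z ξ} := by
  apply IsOpen.measurableSet
  apply IsOpen.and isOpen_ub
  exact (isOpen_Near K).preimage (f := fun ξ => (z, ξ)) (by fun_prop)

def pw {n : ℕ} (p : ℝ) (g : En n → ℂ) : En n → ℝ≥0∞ :=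
  (uball n).indicator (fun z => ‖g z‖ₑ ^ p)

lemma pw_meas {n : ℕ} (p : ℝ) {g : En n → ℂ} (hg : ContinuousOn g (uball n)) :
    Measurable (pw p g) := by
  have h1 : Measurable ((uball n).indicator g) := by
    have := hg.measurable_piecewise (g := (0 : En n → ℂ)) continuousOn_const isOpen_ub.measurableSet
    rwa [Set.piecewise_eq_indicator] at this
  have : pw p g = (uball n).indicator (fun z => ‖(uball n).indicator g z‖ₑ ^ p) := by
    ext z
    by_cases hz : z ∈ uball n <;> simp [pw, hz]
  rw [this]
  apply Measurable.indicator _ isOpen_ub.measurableSet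
  fun_prop

lemma dd_rpow_le {n : ℕ} {K : ℝ} {z w : En n} (h : Near K z w)
    (hz : z ∈ uball n) (hw : w ∈ uball n) (b : ℝ) :
    dd z ^ b ≤ (2 * K) ^ |b| * dd w ^ b := by
  have hz' := mem_ub'.1 hz
  have hw' := mem_ub'.1 hw
  have hK := h.K_pos hz
  have h1 := h.dd_le hz hw
  have h2 := h.symm.dd_le hw hz
  rcases le_total 0 b with hb | hb
  · rw [abs_of_nonneg hb, ← Real.mul_rpow (by positivity) hw'.le]
    exact Real.rpow_le_rpow hz'.le h1 hb
  · rw [abs_of_nonpos hb]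
    have h3 : (2 * K * dd z) ^ b ≤ dd w ^ b := Real.rpow_le_rpow_of_nonpos hw' h2 hb
    rw [Real.mul_rpow (by positivity) hz'.le] at h3
    rw [Real.rpow_neg (by positivity)]
    rw [← div_eq_inv_mul, le_div_iff₀ (by positivity)]
    linarith

/-- pointwise estimate -/
lemma pt (n : ℕ) {p : ℝ} (hp : 0 < p) (K : ℝ) : ∃ K' : ℝ, ∃ C : ℝ≥0∞, C ≠ ⊤ ∧
    ∀ g : En n → ℂ, DifferentiableOn ℂ g (uball n) → ∀ z ∈ uball n, ∀ w ∈ uball n, Near K z w →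
      ‖g w‖ₑ ^ p ≤ C * Avg K' (pw p g) z := by
  obtain ⟨C₁, hC₁, h1⟩ := smv n hp
  set K' := (K + Real.sqrt (2 * K)) * (2 + 2 * K) with hK'
  set q := Module.finrank ℝ (En n) with hq
  set c : ℝ := 1 / 16 with hc
  refine ⟨K', C₁ * (ENNReal.ofReal ((c ^ q)⁻¹) * ENNReal.ofReal ((2 * K) ^ |-((n : ℝ) + 1)|)),
    by finiteness, ?_⟩
  intro g hg z hz w hw hN
  have hd := mem_ub'.1 hw
  set T : En n →ₗ[ℝ] En n := c • ((Lm w).restrictScalars ℝ) with hT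
  have hTa : ∀ v, T v = Lm w (((c : ℝ) : ℂ) • v) := by
    intro v; rw [map_smul]; simp [hT, ← Complex.coe_smul]
  have hdet : |LinearMap.det T| = c ^ q * dd w ^ (n + 1) := by
    rw [hT, LinearMap.det_smul, abs_mul, Lm_det hw, abs_of_pos (by positivity)]
  have hdet0 : LinearMap.det T ≠ 0 := by
    intro h; rw [h, abs_zero] at hdet
    have : 0 < c ^ q * dd w ^ (n + 1) := by positivity
    linarith
  have hsm : ∀ v : En n, ‖v‖ < 2 → ‖((c : ℝ) : ℂ) • v‖ ≤ 1 / 8 := by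
    intro v hv
    rw [norm_smul, Complex.norm_real, Real.norm_of_nonneg (by positivity), hc]; linarith
  have hTc : Continuous T := T.continuous_of_finiteDimensional
  have hinB : ∀ v : En n, ‖v‖ < 2 → w + T v ∈ uball n := by
    intro v hv
    rw [mem_ub', hTa]
    have := dd_add_Lm hw (hsm v hv)
    linarith
  have hinN : ∀ v : En n, ‖v‖ < 2 → Near K' z (w + T v) := by
    intro v hv
    rw [hTa]; exact near_add_Lm hz hw hN (hsm v hv)
  have hh := h1 (fun v => g (w + T v)) (by
    apply hg.comp (t := uball n) (f := fun v => w + T v)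
    · simp only [hTa]
      have : Differentiable ℂ (Lm w) := ((Lm w).toContinuousLinearMap).differentiable
      apply Differentiable.differentiableOn
      fun_prop
    · intro v hv; exact hinB v (by simpa using hv))
  simp only [map_zero, add_zero] at hh
  set S := {ξ | ξ ∈ uball n ∧ Near K' z ξ} with hS
  set F := S.indicator (pw p g) with hF
  have hFm : Measurable F := (pw_meas p hg.continuousOn).indicator (meas_S K' z)
  have e1 : ∫⁻ v in Metric.ball 0 1, ‖g (w + T v)‖ₑ ^ p ∂vol n ≤ ∫⁻ v, F (w + T v) ∂vol n := by
    refine le_trans ?_ (setLIntegral_le_lintegral (Metric.ball 0 1) _)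
    apply setLIntegral_mono' measurableSet_ball
    intro v hv
    have hv2 : ‖v‖ < 2 := by rw [mem_ball_zero_iff] at hv; linarith
    have hmem : w + T v ∈ S := ⟨hinB v hv2, hinN v hv2⟩
    rw [hF, Set.indicator_of_mem hmem, pw, Set.indicator_of_mem (hinB v hv2)]
  have e2 : ∫⁻ v, F (w + T v) ∂vol n = ENNReal.ofReal (c ^ q * dd w ^ (n + 1))⁻¹ * ∫⁻ ξ, F ξ ∂vol n := by
    have a1 : ∫⁻ v, F (w + T v) ∂vol n = ∫⁻ x, F (w + x) ∂(Measure.map T (vol n)) := by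
      rw [lintegral_map (by fun_prop) hTc.measurable]
    rw [a1, Measure.map_linearMap_addHaar_eq_smul_addHaar _ hdet0, lintegral_smul_measure,
      lintegral_add_left_eq_self, abs_inv, hdet, smul_eq_mul]
  have e3 : ∫⁻ ξ, F ξ ∂vol n = ∫⁻ ξ in S, pw p g ξ ∂vol n := lintegral_indicator (meas_S K' z) _
  have e4 : ENNReal.ofReal (c ^ q * dd w ^ (n + 1))⁻¹ ≤
      ENNReal.ofReal ((c ^ q)⁻¹) * ENNReal.ofReal ((2 * K) ^ |-((n : ℝ) + 1)|) *
        ENNReal.ofReal (dd z ^ (-((n : ℝ) + 1))) := by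
    have hK := hN.K_pos hz
    rw [← ENNReal.ofReal_mul (by positivity), ← ENNReal.ofReal_mul (by positivity)]
    apply ENNReal.ofReal_le_ofReal
    rw [mul_inv, mul_assoc]
    gcongr
    have := dd_rpow_le hN.symm hw hz (-((n : ℝ) + 1))
    refine le_trans (le_of_eq ?_) this
    rw [Real.rpow_neg hd.le]
    congr 1
    exact_mod_cast (Real.rpow_natCast (dd w) (n + 1)).symm
  calc _ ≤ _ := hh
    _ ≤ C₁ * (ENNReal.ofReal ((c ^ q)⁻¹) * ENNReal.ofReal ((2 * K) ^ |-((n : ℝ) + 1)|) *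
        ENNReal.ofReal (dd z ^ (-((n : ℝ) + 1))) * ∫⁻ ξ in S, pw p g ξ ∂vol n) := by
        gcongr
        refine e1.trans ?_
        rw [e2, e3]
        gcongr
    _ = _ := by rw [Avg]; ring

lemma Avg_meas {n : ℕ} (K : ℝ) {F : En n → ℝ≥0∞} (hF : Measurable F) : Measurable (Avg K F) := by
  have h1 : Avg K F = fun z => ENNReal.ofReal (dd z ^ (-((n : ℝ) + 1))) *
      ∫⁻ ξ, {x : En n × En n | x.2 ∈ uball n ∧ Near K x.1 x.2}.indicator (fun x => F x.2) (z, ξ) ∂vol n := by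
    ext z
    rw [Avg, ← lintegral_indicator (meas_S K z)]
    rfl
  rw [h1]
  have hd := (continuous_dd (n := n)).measurable
  apply Measurable.mul
  · fun_prop
  · apply Measurable.lintegral_prod_right'
      (f := {x : En n × En n | x.2 ∈ uball n ∧ Near K x.1 x.2}.indicator (fun x => F x.2))
    apply Measurable.indicator (by fun_prop)
    apply IsOpen.measurableSet
    apply IsOpen.and _ (isOpen_Near K)
    exact isOpen_ub.preimage continuous_snd

lemma Avg_int (n : ℕ) (K a : ℝ) : ∃ C : ℝ≥0∞, C ≠ ⊤ ∧ ∀ F : En n → ℝ≥0∞, Measurable F →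
    ∫⁻ z in uball n, ENNReal.ofReal (dd z ^ a) * Avg K F z ∂vol n ≤
      C * ∫⁻ ξ in uball n, ENNReal.ofReal (dd ξ ^ a) * F ξ ∂vol n := by
  obtain ⟨C₁, hC₁, hvol⟩ := vol_near n K
  set b := a + -((n : ℝ) + 1) with hb
  refine ⟨ENNReal.ofReal ((2 * K) ^ |b|) * C₁, by finiteness, fun F hF => ?_⟩
  set P := {x : En n × En n | (x.1 ∈ uball n ∧ x.2 ∈ uball n) ∧ Near K x.1 x.2} with hP
  set H : En n × En n → ℝ≥0∞ := P.indicator (fun x => ENNReal.ofReal (dd x.1 ^ b) * F x.2) with hH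
  have hd := (continuous_dd (n := n)).measurable
  have hPm : MeasurableSet P := by
    apply IsOpen.measurableSet
    apply IsOpen.and _ (isOpen_Near K)
    exact (isOpen_ub.preimage continuous_fst).inter (isOpen_ub.preimage continuous_snd)
  have hHm : Measurable H := by
    apply Measurable.indicator _ hPm
    fun_prop
  have e1 : ∫⁻ z in uball n, ENNReal.ofReal (dd z ^ a) * Avg K F z ∂vol n
      ≤ ∫⁻ z, ∫⁻ ξ, H (z, ξ) ∂vol n ∂vol n := by
    refine le_trans ?_ (setLIntegral_le_lintegral (uball n) _)
    apply setLIntegral_mono' isOpen_ub.measurableSet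
    intro z hz
    have hz' := mem_ub'.1 hz
    rw [Avg, ← mul_assoc, ← ENNReal.ofReal_mul (by positivity), ← Real.rpow_add hz', ← hb,
      ← lintegral_const_mul _ hF, ← lintegral_indicator (meas_S K z)]
    apply lintegral_mono
    intro ξ
    by_cases hx : ξ ∈ {ξ | ξ ∈ uball n ∧ Near K z ξ}
    · have : (z, ξ) ∈ P := ⟨⟨hz, hx.1⟩, hx.2⟩
      simp only [hH]
      rw [Set.indicator_of_mem hx, Set.indicator_of_mem this]
    · simp only
      rw [Set.indicator_of_notMem hx]; exact zero_le
  refine e1.trans ?_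
  rw [lintegral_lintegral_swap (f := fun z ξ => H (z, ξ)) hHm.aemeasurable, ← lintegral_const_mul _ (by fun_prop),
    ← lintegral_indicator isOpen_ub.measurableSet]
  apply lintegral_mono
  intro ξ
  by_cases hξ : ξ ∈ uball n
  · have hξ' := mem_ub'.1 hξ
    simp only
    rw [Set.indicator_of_mem hξ]
    have hS : MeasurableSet {z | z ∈ uball n ∧ Near K z ξ} := by
      have := meas_S K ξ
      convert this using 4
      exact ⟨Near.symm, Near.symm⟩
    calc ∫⁻ z, H (z, ξ) ∂vol n
        ≤ ∫⁻ z in {z | z ∈ uball n ∧ Near K z ξ},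
            ENNReal.ofReal ((2 * K) ^ |b| * dd ξ ^ b) * F ξ ∂vol n := by
          rw [← lintegral_indicator hS]
          apply lintegral_mono
          intro z
          by_cases hx : (z, ξ) ∈ P
          · have h2 : z ∈ {z | z ∈ uball n ∧ Near K z ξ} := ⟨hx.1.1, hx.2⟩
            simp only [hH]
            rw [Set.indicator_of_mem h2, Set.indicator_of_mem hx]
            gcongr
            exact dd_rpow_le hx.2 hx.1.1 hx.1.2 b
          · simp only [hH]
            rw [Set.indicator_of_notMem hx]; exact zero_le
      _ = ENNReal.ofReal ((2 * K) ^ |b| * dd ξ ^ b) * F ξ * vol n {z | z ∈ uball n ∧ Near K z ξ} := by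
          rw [setLIntegral_const]
      _ ≤ ENNReal.ofReal ((2 * K) ^ |b| * dd ξ ^ b) * F ξ * (C₁ * ENNReal.ofReal (dd ξ ^ (n + 1))) := by
          gcongr; exact hvol ξ hξ
      _ = _ := by
          have : dd ξ ^ a = dd ξ ^ b * dd ξ ^ (n + 1) := by
            rw [← Real.rpow_natCast, ← Real.rpow_add hξ', hb]; congr 1; push_cast; ring
          rw [this, ENNReal.ofReal_mul' (by positivity), ENNReal.ofReal_mul (by positivity)]
          ring
  · have : ∀ z, H (z, ξ) = 0 := fun z => Set.indicator_of_notMem (fun h => hξ h.1.2) _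
    simp [this]

lemma B_real {n : ℕ} {g : En n → ℂ} (hg : DifferentiableOn ℂ g (uball n)) {w : En n}
    (hw : w ∈ uball n) {M : ℝ} (hM : ∀ ξ ∈ uball n, Near 9 w ξ → ‖g ξ‖ ≤ M) :
    dd w * ‖radD g w‖ ≤ 8 * M := by
  have hd := mem_ub'.1 hw
  have hd1 := dd_le_one w
  have hw1 := mem_ub.1 hw
  have hnear : ∀ ξ ∈ Metric.ball w (dd w / 4), ξ ∈ uball n ∧ Near 9 w ξ := by
    intro ξ hξ
    rw [mem_ball_iff_norm] at hξ
    have h1 : dd w / 4 ≤ dd ξ := by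
      have := norm_sub_norm_le ξ w
      have h2 : ‖ξ‖ ≤ ‖w‖ + dd w / 4 := by linarith
      have h3 : ‖ξ‖ ^ 2 ≤ (‖w‖ + dd w / 4) ^ 2 := by gcongr
      have h4 : dd ξ = 1 - ‖ξ‖ ^ 2 := rfl
      have h5 : dd w = 1 - ‖w‖ ^ 2 := rfl
      nlinarith [norm_nonneg w]
    have h2 : ‖1 - herm w ξ‖ ≤ 2 * dd w := by
      have e : 1 - herm w ξ = ((dd w : ℝ) : ℂ) - inner ℂ (ξ - w) w := by
        rw [herm_eq, inner_sub_left, inner_self_C]; push_cast; ring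
      rw [e]
      have := norm_sub_le ((dd w : ℝ) : ℂ) (inner ℂ (ξ - w) w)
      rw [Complex.norm_real, Real.norm_of_nonneg hd.le] at this
      have h3 : ‖(inner ℂ (ξ - w) w : ℂ)‖ ≤ (dd w / 4) * 1 := by
        refine (norm_inner_le_norm _ _).trans ?_
        gcongr
      linarith
    refine ⟨mem_ub'.2 (by linarith), by linarith, by linarith⟩
  have hs : ‖fderiv ℂ g w‖ ≤ (2 * M) / (dd w / 4) := by
    apply Complex.norm_fderiv_le_div_of_mapsTo_ball _ _ (by linarith)
    · exact hg.mono fun y hy => (hnear y hy).1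
    · intro y hy
      rw [mem_closedBall_iff_norm]
      have h1 := hM y (hnear y hy).1 (hnear y hy).2
      have hww := hnear w (Metric.mem_ball_self (by linarith))
      have h2 := hM w hww.1 hww.2
      have := norm_sub_le (g y) (g w)
      linarith
  have h2 : ‖radD g w‖ ≤ (2 * M) / (dd w / 4) := by
    calc _ ≤ ‖fderiv ℂ g w‖ * ‖w‖ := (fderiv ℂ g w).le_opNorm w
      _ ≤ ‖fderiv ℂ g w‖ * 1 := by gcongr
      _ ≤ _ := by linarith
  calc dd w * ‖radD g w‖ ≤ dd w * ((2 * M) / (dd w / 4)) := by gcongr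
    _ = 8 * M := by field_simp; ring

lemma deriv_line {n : ℕ} {g : En n → ℂ} (hg : DifferentiableOn ℂ g (uball n)) {z : En n} {l : ℂ}
    (h : l • z ∈ uball n) : HasDerivAt (fun l : ℂ => g (l • z)) (fderiv ℂ g (l • z) z) l := by
  have h1 : HasFDerivAt g (fderiv ℂ g (l • z)) (l • z) :=
    (hg.differentiableAt (isOpen_ub.mem_nhds h)).hasFDerivAt
  have h2 : HasDerivAt (fun l : ℂ => l • z) ((1 : ℂ) • z) l := by
    simpa using (hasDerivAt_id l).smul_const z
  have := h1.comp_hasDerivAt l h2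
  rwa [one_smul] at this

lemma radD_line {n : ℕ} (g : En n → ℂ) (z : En n) (l : ℂ) :
    radD g (l • z) = l * fderiv ℂ g (l • z) z := by
  rw [radD, map_smul, smul_eq_mul]

lemma C1_real {n : ℕ} {g : En n → ℂ} (hg : DifferentiableOn ℂ g (uball n)) {z : En n}
    (hz : ‖z‖ ≤ 4 / 5) {M : ℝ} (hM : ∀ ξ ∈ uball n, Near 6 z ξ → ‖radD g ξ‖ ≤ M) :
    ‖g z‖ ≤ ‖g 0‖ + M := by
  have hU : IsOpen {l : ℂ | l • z ∈ uball n} := by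
    apply isOpen_ub.preimage; fun_prop
  have hin : ∀ l ∈ Metric.closedBall (0 : ℂ) 1, l • z ∈ uball n := by
    intro l hl
    rw [mem_closedBall_zero_iff] at hl
    rw [mem_ub, norm_smul]
    nlinarith [norm_nonneg z]
  have hd : DifferentiableOn ℂ (fun l : ℂ => g (l • z)) {l : ℂ | l • z ∈ uball n} :=
    fun l hl => (deriv_line hg hl).differentiableAt.differentiableWithinAt
  have hdd : DifferentiableOn ℂ (deriv (fun l : ℂ => g (l • z))) {l : ℂ | l • z ∈ uball n} :=
    hd.deriv hU
  have hbd : ∀ l ∈ Metric.closedBall (0 : ℂ) 1, ‖deriv (fun l : ℂ => g (l • z)) l‖ ≤ M := by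
    intro l hl
    have hcl : closure (Metric.ball (0 : ℂ) 1) = Metric.closedBall 0 1 := closure_ball _ one_ne_zero
    apply Complex.norm_le_of_forall_mem_frontier_norm_le (U := Metric.ball (0 : ℂ) 1)
      Metric.isBounded_ball _ _ (by rwa [hcl])
    · constructor
      · exact hdd.mono fun l hl => hin l (Metric.ball_subset_closedBall hl)
      · rw [hcl]; exact hdd.continuousOn.mono hin
    · intro m hm
      rw [frontier_ball _ one_ne_zero] at hm
      have hmB := hin m (Metric.sphere_subset_closedBall hm)
      rw [mem_sphere_zero_iff_norm] at hm
      rw [(deriv_line hg hmB).deriv]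
      have h1 := hM (m • z) hmB (by
        have e1 : ‖m • z‖ = ‖z‖ := by rw [norm_smul, hm, one_mul]
        have e2 : dd (m • z) = dd z := by simp [dd, e1]
        have e3 : ‖1 - herm z (m • z)‖ ≤ 1 + ‖z‖ * ‖z‖ := by
          refine (norm_sub_le _ _).trans ?_
          have := herm_norm_le z (m • z)
          rw [e1] at this
          simpa using this
        have e4 : ‖z‖ ^ 2 ≤ 16 / 25 := by nlinarith [norm_nonneg z]
        have e5 : dd z = 1 - ‖z‖ ^ 2 := rfl
        constructor
        · nlinarith
        · rw [e2]; nlinarith)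
      rw [radD_line, norm_mul, hm, one_mul] at h1
      exact h1
  have := (convex_closedBall (0 : ℂ) 1).norm_image_sub_le_of_norm_deriv_le (𝕜 := ℂ)
    (f := fun l : ℂ => g (l • z)) (fun l hl => (deriv_line hg (hin l hl)).differentiableAt) hbd
    (x := 0) (y := 1) (by simp) (by simp)
  simp at this
  have h2 := norm_sub_norm_le (g z) (g 0)
  linarith

lemma C2_real {n : ℕ} {g : En n → ℂ} (hg : DifferentiableOn ℂ g (uball n)) {ζ : En n}
    (hζ : ‖ζ‖ = 1) {x M : ℝ} (hx : 0 < x) (hx4 : x ≤ 1 / 4)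
    (hM : ∀ ξ ∈ uball n, Near 4 ((1 - x) • ζ) ξ → ‖radD g ξ‖ ≤ M) :
    ‖g ((1 - x) • ζ)‖ ≤ ‖g ((1 - 2 * x) • ζ)‖ + 2 * x * M := by
  have hnorm : ∀ t : ℝ, 0 ≤ t → ‖t • ζ‖ = t := by
    intro t ht; rw [norm_smul, hζ, Real.norm_of_nonneg ht, mul_one]
  have hin : ∀ t ∈ Set.Icc (1 - 2 * x) (1 - x), t • ζ ∈ uball n := by
    intro t ht
    rw [mem_ub, hnorm t (by linarith [ht.1])]; linarith [ht.2]
  have hcs : ∀ t : ℝ, ((t : ℝ) : ℂ) • ζ = t • ζ := fun t => Complex.coe_smul t ζ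
  have key := norm_image_sub_le_of_norm_deriv_le_segment' (f := fun t : ℝ => g (t • ζ))
    (f' := fun t : ℝ => fderiv ℂ g (t • ζ) ζ) (C := 2 * M) (a := 1 - 2 * x) (b := 1 - x) ?_ ?_
    (1 - x) ⟨by linarith, le_rfl⟩
  · have h2 := norm_sub_norm_le (g ((1 - x) • ζ)) (g ((1 - 2 * x) • ζ))
    have h3 : 2 * M * (1 - x - (1 - 2 * x)) = 2 * x * M := by ring
    rw [h3] at key
    linarith
  · intro t ht
    apply HasDerivAt.hasDerivWithinAt
    have h1 := deriv_line hg (z := ζ) (l := (t : ℂ)) (by rw [hcs]; exact hin t ht)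
    have := h1.comp_ofReal
    simpa only [hcs] using this
  · intro t ht
    have ht' : t ∈ Set.Icc (1 - 2 * x) (1 - x) := ⟨ht.1, ht.2.le⟩
    have ht0 : 1 / 2 ≤ t := by linarith [ht.1]
    have h1 := hM (t • ζ) (hin t ht') (by
      have e1 : herm ((1 - x) • ζ) (t • ζ) = (((1 - x) * t : ℝ) : ℂ) := by
        rw [← hcs, ← hcs, herm_eq, inner_smul_left, inner_smul_right, inner_self_eq_norm_sq_to_K, hζ]
        simp; ring
      have e2 : ‖1 - herm ((1 - x) • ζ) (t • ζ)‖ = 1 - (1 - x) * t := by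
        rw [e1, ← Complex.ofReal_one, ← Complex.ofReal_sub, Complex.norm_real, Real.norm_of_nonneg]
        nlinarith [ht'.2]
      have e3 : dd ((1 - x) • ζ) = 1 - (1 - x) ^ 2 := by rw [dd, hnorm _ (by linarith)]
      have e4 : dd (t • ζ) = 1 - t ^ 2 := by rw [dd, hnorm _ (by linarith)]
      constructor
      · rw [e2, e3]; nlinarith [ht'.1, ht'.2]
      · rw [e2, e4]; nlinarith [ht'.1, ht'.2])
    rw [← hcs, radD_line, norm_mul, Complex.norm_real, Real.norm_of_nonneg (by linarith)] at h1
    rw [← hcs]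
    have := norm_nonneg (fderiv ℂ g ((t : ℂ) • ζ) ζ)
    nlinarith

def II {n : ℕ} (p a : ℝ) (g : En n → ℂ) : ℝ≥0∞ :=
  ∫⁻ z in uball n, ENNReal.ofReal (dd z ^ a) * pw p g z ∂vol n

lemma term_pow {d : ℝ} (hd : 0 < d) {p : ℝ} (hp : 0 < p) (k : ℝ) (x : ℂ) :
    (ENNReal.ofReal (d ^ k * ‖x‖)) ^ p = ENNReal.ofReal (d ^ (p * k)) * ‖x‖ₑ ^ p := by
  rw [ENNReal.ofReal_mul (by positivity), ENNReal.mul_rpow_of_nonneg _ _ hp.le,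
    ENNReal.ofReal_rpow_of_nonneg (by positivity) hp.le, ← Real.rpow_mul hd.le, ofReal_norm_eq_enorm,
    mul_comm k p]

lemma thmA (n : ℕ) {p : ℝ} (hp : 0 < p) (γ α k : ℝ) : ∃ C : ℝ≥0∞, C ≠ ⊤ ∧ ∀ g : En n → ℂ,
    DifferentiableOn ℂ g (uball n) →
    ∫⁻ z in uball n, ENNReal.ofReal (dd z ^ α) *
      (maxF γ (fun w => (1 - ‖w‖ ^ 2) ^ k * ‖g w‖) z) ^ p ∂vol n ≤ C * II p (p * k + α) g := by
  set K := 2 * Real.exp (2 * γ) with hK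
  obtain ⟨K', C₁, hC₁, h1⟩ := pt n hp K
  obtain ⟨C₂, hC₂, h2⟩ := Avg_int n K' (p * k + α)
  refine ⟨ENNReal.ofReal ((2 * K) ^ |p * k|) * C₁ * C₂, by finiteness, fun g hg => ?_⟩
  have hpm := pw_meas p hg.continuousOn
  calc _ ≤ ∫⁻ z in uball n, ENNReal.ofReal ((2 * K) ^ |p * k|) * C₁ *
        (ENNReal.ofReal (dd z ^ (p * k + α)) * Avg K' (pw p g) z) ∂vol n := by
        apply setLIntegral_mono' isOpen_ub.measurableSet
        intro z hz
        have hz' := mem_ub'.1 hz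
        have key : (maxF γ (fun w => (1 - ‖w‖ ^ 2) ^ k * ‖g w‖) z) ^ p ≤
            ENNReal.ofReal ((2 * K) ^ |p * k|) * C₁ *
              (ENNReal.ofReal (dd z ^ (p * k)) * Avg K' (pw p g) z) := by
          rw [← ENNReal.le_rpow_inv_iff hp, maxF]
          apply iSup₂_le
          intro w hw
          rw [ENNReal.le_rpow_inv_iff hp]
          have hwb : w ∈ uball n := hw.1
          have hN := near_of_Dball hz hw
          have hw' := mem_ub'.1 hwb
          have := term_pow hw' hp k (g w)
          rw [dd] at this
          rw [this]
          calc _ ≤ ENNReal.ofReal ((2 * K) ^ |p * k| * dd z ^ (p * k)) * (C₁ * Avg K' (pw p g) z) := by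
                gcongr
                · exact dd_rpow_le hN.symm hwb hz _
                · exact h1 g hg z hz w hwb hN
            _ = _ := by
                rw [ENNReal.ofReal_mul (by positivity)]; ring
        calc _ ≤ ENNReal.ofReal (dd z ^ α) * (ENNReal.ofReal ((2 * K) ^ |p * k|) * C₁ *
              (ENNReal.ofReal (dd z ^ (p * k)) * Avg K' (pw p g) z)) := by gcongr
          _ = _ := by
            rw [Real.rpow_add hz', ENNReal.ofReal_mul (by positivity)]; ring
    _ = ENNReal.ofReal ((2 * K) ^ |p * k|) * C₁ * ∫⁻ z in uball n,
        (ENNReal.ofReal (dd z ^ (p * k + α)) * Avg K' (pw p g) z) ∂vol n := by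
        rw [lintegral_const_mul']
        finiteness
    _ ≤ ENNReal.ofReal ((2 * K) ^ |p * k|) * C₁ * (C₂ * II p (p * k + α) g) := by
        gcongr; exact h2 _ hpm
    _ = _ := by ring

lemma thmA' (n : ℕ) {p : ℝ} (hp : 0 < p) {γ : ℝ} (hγ : 0 < γ) (α k : ℝ) (g : En n → ℂ) :
    II p (p * k + α) g ≤ ∫⁻ z in uball n, ENNReal.ofReal (dd z ^ α) *
      (maxF γ (fun w => (1 - ‖w‖ ^ 2) ^ k * ‖g w‖) z) ^ p ∂vol n := by
  apply setLIntegral_mono' isOpen_ub.measurableSet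
  intro z hz
  have hz' := mem_ub'.1 hz
  have := term_pow hz' hp k (g z)
  rw [add_comm, Real.rpow_add hz', ENNReal.ofReal_mul (by positivity), mul_assoc, pw,
    Set.indicator_of_mem hz, ← this]
  gcongr
  exact le_iSup₂_of_le (f := fun w _ => ENNReal.ofReal ((1 - ‖w‖ ^ 2) ^ k * ‖g w‖)) z
    (self_mem_Dball hγ hz) le_rfl

lemma le_toReal_of {p : ℝ} (hp : 0 < p) {Y : ℝ≥0∞} (hY : Y ≠ ⊤) {x : ℂ} (h : ‖x‖ₑ ^ p ≤ Y) :
    ‖x‖ ≤ (Y ^ p⁻¹).toReal := by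
  rw [← ENNReal.le_rpow_inv_iff hp] at h
  rw [← toReal_enorm]
  exact ENNReal.toReal_mono (by finiteness) h

lemma thmB (n : ℕ) {p : ℝ} (hp : 0 < p) (a : ℝ) : ∃ C : ℝ≥0∞, C ≠ ⊤ ∧ ∀ g : En n → ℂ,
    DifferentiableOn ℂ g (uball n) → II p (a + p) (radD g) ≤ C * II p a g := by
  obtain ⟨K', C₁, hC₁, h1⟩ := pt n hp 9
  obtain ⟨C₂, hC₂, h2⟩ := Avg_int n K' a
  refine ⟨(8 : ℝ≥0∞) ^ p * C₁ * C₂, by finiteness, fun g hg => ?_⟩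
  have hpm := pw_meas p hg.continuousOn
  calc _ ≤ ∫⁻ z in uball n, (8 : ℝ≥0∞) ^ p * C₁ *
        (ENNReal.ofReal (dd z ^ a) * Avg K' (pw p g) z) ∂vol n := by
        apply setLIntegral_mono' isOpen_ub.measurableSet
        intro z hz
        have hz' := mem_ub'.1 hz
        rw [pw, Set.indicator_of_mem hz, Real.rpow_add hz', ENNReal.ofReal_mul (by positivity)]
        have key : ENNReal.ofReal (dd z ^ p) * ‖radD g z‖ₑ ^ p ≤
            8 ^ p * (C₁ * Avg K' (pw p g) z) := by
          by_cases hY : C₁ * Avg K' (pw p g) z = ⊤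
          · rw [hY, ENNReal.mul_top]
            · exact le_top
            · simp [hp.le]
          · have := B_real hg hz (M := ((C₁ * Avg K' (pw p g) z) ^ p⁻¹).toReal)
              (fun ξ hξ hN => le_toReal_of hp hY (h1 g hg z hz ξ hξ hN))
            have h3 := term_pow hz' hp 1 (radD g z)
            rw [mul_one, Real.rpow_one] at h3
            rw [← h3]
            calc _ ≤ (ENNReal.ofReal (8 * ((C₁ * Avg K' (pw p g) z) ^ p⁻¹).toReal)) ^ p := by
                  gcongr
              _ = _ := by
                  rw [ENNReal.ofReal_mul (by norm_num), ENNReal.ofReal_toReal (by finiteness),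
                    ENNReal.mul_rpow_of_nonneg _ _ hp.le, ENNReal.rpow_inv_rpow hp.ne']
                  norm_num
        calc _ = ENNReal.ofReal (dd z ^ a) * (ENNReal.ofReal (dd z ^ p) * ‖radD g z‖ₑ ^ p) := by ring
          _ ≤ ENNReal.ofReal (dd z ^ a) * (8 ^ p * (C₁ * Avg K' (pw p g) z)) := by gcongr
          _ = _ := by ring
    _ = (8 : ℝ≥0∞) ^ p * C₁ * ∫⁻ z in uball n,
        (ENNReal.ofReal (dd z ^ a) * Avg K' (pw p g) z) ∂vol n := by
        rw [lintegral_const_mul']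
        finiteness
    _ ≤ (8 : ℝ≥0∞) ^ p * C₁ * (C₂ * II p a g) := by
        gcongr; exact h2 _ hpm
    _ = _ := by ring

lemma add_pow_le2 {p : ℝ} (hp : 0 < p) (a b : ℝ≥0∞) : (a + b) ^ p ≤ 2 ^ p * (a ^ p + b ^ p) := by
  have h : a + b ≤ 2 * max a b := by
    rw [two_mul]; exact add_le_add (le_max_left _ _) (le_max_right _ _)
  calc _ ≤ (2 * max a b) ^ p := by gcongr
    _ = 2 ^ p * (max a b) ^ p := ENNReal.mul_rpow_of_nonneg _ _ hp.le
    _ ≤ _ := by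
      gcongr
      rcases max_cases a b with h | h <;> rw [h.1]
      · exact le_self_add
      · exact le_add_self

lemma hardy_pt {p δ : ℝ} (hp : 0 < p) (hδ : 0 < δ) {U h : ℝ → ℝ≥0∞} {u0 : ℝ≥0∞}
    (h1 : ∀ x, 0 < x → x ≤ 1 / 4 → U x ≤ U (2 * x) + h x)
    (h2 : ∀ x, 1 / 4 < x → x ≤ 1 / 2 → U x ≤ u0 + h x)
    (G S : ℝ → ℝ≥0∞) (hG : ∀ x, 0 < x → x ≤ 1 / 2 → G x = ENNReal.ofReal (x ^ δ) * h x ^ p)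
    (hS : ∀ x, S x = G x + S (2 * x)) (j : ℕ) :
    ∀ x, 1 / 2 ^ (j + 2) < x → x ≤ 1 / 2 →
      U x ≤ u0 + ENNReal.ofReal ((1 - 2 ^ (-(δ / p)))⁻¹ * x ^ (-(δ / p))) * S x ^ p⁻¹ := by
  set θ : ℝ := 2 ^ (-(δ / p)) with hθ
  have hθ0 : 0 < θ := by positivity
  have hθ1 : θ < 1 := by
    rw [hθ]; apply Real.rpow_lt_one_of_one_lt_of_neg (by norm_num)
    have : 0 < δ / p := by positivity
    linarith
  have hC1 : 1 ≤ (1 - θ)⁻¹ := by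
    rw [one_le_inv₀ (by linarith)]; linarith
  have hh : ∀ x, 0 < x → x ≤ 1 / 2 → h x ≤ ENNReal.ofReal (x ^ (-(δ / p))) * S x ^ p⁻¹ := by
    intro x hx hx2
    have e : h x = ENNReal.ofReal (x ^ (-(δ / p))) * G x ^ p⁻¹ := by
      rw [hG x hx hx2, ENNReal.mul_rpow_of_nonneg _ _ (by positivity), ENNReal.rpow_rpow_inv hp.ne',
        ENNReal.ofReal_rpow_of_nonneg (by positivity) (by positivity), ← mul_assoc,
        ← ENNReal.ofReal_mul (by positivity), ← Real.rpow_mul hx.le, ← Real.rpow_add hx]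
      have : -(δ / p) + δ * p⁻¹ = 0 := by field_simp; ring
      rw [this]; simp
    rw [e]
    gcongr
    rw [hS x]; exact le_self_add
  have base : ∀ x, 1 / 4 < x → x ≤ 1 / 2 →
      U x ≤ u0 + ENNReal.ofReal ((1 - θ)⁻¹ * x ^ (-(δ / p))) * S x ^ p⁻¹ := by
    intro x hx hx2
    have hx0 : 0 < x := by linarith
    refine (h2 x hx hx2).trans ?_
    gcongr
    refine (hh x hx0 hx2).trans ?_
    gcongr
    exact le_mul_of_one_le_left (by positivity) hC1
  induction j with
  | zero => intro x hx hx2; exact base x (by norm_num at hx ⊢; exact hx) hx2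
  | succ j ih =>
    intro x hx hx2
    have hx0 : 0 < x := lt_trans (by positivity) hx
    by_cases hx4 : 1 / 4 < x
    · exact base x hx4 hx2
    push Not at hx4
    have h3 := ih (2 * x) (by
      have : (1 : ℝ) / 2 ^ (j + 2) = 2 * (1 / 2 ^ (j + 1 + 2)) := by
        field_simp; ring
      rw [this]; linarith) (by linarith)
    calc U x ≤ U (2 * x) + h x := h1 x hx0 hx4
      _ ≤ (u0 + ENNReal.ofReal ((1 - θ)⁻¹ * (2 * x) ^ (-(δ / p))) * S x ^ p⁻¹) +
          ENNReal.ofReal (x ^ (-(δ / p))) * S x ^ p⁻¹ := by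
          gcongr
          · refine h3.trans ?_
            gcongr
            rw [hS x]; exact le_add_self
          · exact hh x hx0 hx2
      _ = u0 + ENNReal.ofReal ((1 - θ)⁻¹ * (2 * x) ^ (-(δ / p)) + x ^ (-(δ / p))) * S x ^ p⁻¹ := by
          have : 0 < (1 - θ)⁻¹ := by linarith
          rw [ENNReal.ofReal_add (by positivity) (by positivity)]; ring
      _ = _ := by
          congr 3
          rw [Real.mul_rpow (by norm_num) hx0.le, ← hθ]
          have : 1 - θ ≠ 0 := by linarith
          field_simp
          ring

lemma hardy {p a : ℝ} (hp : 0 < p) (ha : -1 < a) : ∃ C : ℝ≥0∞, C ≠ ⊤ ∧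
    ∀ (U h : ℝ → ℝ≥0∞) (u0 : ℝ≥0∞), Measurable h →
    (∀ x, 0 < x → x ≤ 1 / 4 → U x ≤ U (2 * x) + h x) →
    (∀ x, 1 / 4 < x → x ≤ 1 / 2 → U x ≤ u0 + h x) →
    ∫⁻ x in Set.Ioc (0 : ℝ) (1 / 2), ENNReal.ofReal (x ^ a) * U x ^ p ≤
      C * (u0 ^ p + ∫⁻ x in Set.Ioc (0 : ℝ) (1 / 2), ENNReal.ofReal (x ^ a) * h x ^ p) := by
  set δ := (a + 1) / 2 with hδd
  have hδ : 0 < δ := by rw [hδd]; linarith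
  set A := (1 - (2 : ℝ) ^ (-(δ / p)))⁻¹ with hA
  have hA0 : 0 < A := by
    rw [hA]; apply inv_pos.2
    have : (2 : ℝ) ^ (-(δ / p)) < 1 := by
      apply Real.rpow_lt_one_of_one_lt_of_neg (by norm_num)
      have : 0 < δ / p := by positivity
      linarith
    linarith
  set C₀ : ℝ≥0∞ := ∫⁻ x in Set.Ioc (0 : ℝ) (1 / 2), ENNReal.ofReal (x ^ a) with hC₀
  have hC₀t : C₀ ≠ ⊤ := by
    have : IntegrableOn (fun x : ℝ => x ^ a) (Set.Ioc 0 (1 / 2)) := by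
      rw [← intervalIntegrable_iff_integrableOn_Ioc_of_le (by norm_num)]
      exact intervalIntegral.intervalIntegrable_rpow' ha
    exact this.lintegral_lt_top.ne
  set C₁ : ℝ≥0∞ := ∑' i : ℕ, (ENNReal.ofReal (2 ^ (-δ))) ^ i with hC₁
  have hC₁t : C₁ ≠ ⊤ := by
    rw [hC₁, ENNReal.tsum_geometric]
    apply ENNReal.inv_ne_top.2
    have : ENNReal.ofReal (2 ^ (-δ)) < 1 := by
      rw [ENNReal.ofReal_lt_one]
      exact Real.rpow_lt_one_of_one_lt_of_neg (by norm_num) (by linarith)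
    exact (tsub_pos_of_lt this).ne'
  refine ⟨2 ^ p * (C₀ + ENNReal.ofReal (A ^ p) * C₁), by finiteness, fun U h u0 hm h1 h2 => ?_⟩
  set G : ℝ → ℝ≥0∞ := (Set.Ioc (0 : ℝ) (1 / 2)).indicator (fun x => ENNReal.ofReal (x ^ δ) * h x ^ p) with hG
  set W : ℝ → ℝ≥0∞ := (Set.Ioc (0 : ℝ) (1 / 2)).indicator (fun x => ENNReal.ofReal (x ^ a) * h x ^ p) with hW
  have hGm : Measurable G := Measurable.indicator (by fun_prop) measurableSet_Ioc
  have hWm : Measurable W := Measurable.indicator (by fun_prop) measurableSet_Ioc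
  set S : ℝ → ℝ≥0∞ := fun x => ∑' i : ℕ, G (2 ^ i * x) with hS
  have hS2 : ∀ x, S x = G x + S (2 * x) := by
    intro x
    simp only [hS]
    rw [tsum_eq_zero_add' ENNReal.summable]
    simp only [pow_zero, one_mul, pow_succ, mul_assoc]
  have hU : ∀ x ∈ Set.Ioc (0 : ℝ) (1 / 2), ENNReal.ofReal (x ^ a) * U x ^ p ≤
      2 ^ p * (ENNReal.ofReal (x ^ a) * u0 ^ p +
        ENNReal.ofReal (A ^ p) * (ENNReal.ofReal (x ^ (a - δ)) * S x)) := by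
    intro x ⟨hx0, hx2⟩
    obtain ⟨j, hj⟩ := exists_pow_lt_of_lt_one hx0 (show (1 / 2 : ℝ) < 1 by norm_num)
    have hj' : 1 / 2 ^ (j + 2) < x := by
      refine lt_of_le_of_lt ?_ hj
      rw [div_pow, one_pow]
      gcongr
      · norm_num
      · omega
    have h3 := hardy_pt hp hδ h1 h2 G S (fun x hx hx2 => by
      rw [hG, Set.indicator_of_mem (show x ∈ Set.Ioc (0 : ℝ) (1 / 2) from ⟨hx, hx2⟩)]) hS2 j x hj' hx2
    calc _ ≤ ENNReal.ofReal (x ^ a) * (u0 + ENNReal.ofReal (A * x ^ (-(δ / p))) * S x ^ p⁻¹) ^ p := by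
          gcongr
      _ ≤ ENNReal.ofReal (x ^ a) * (2 ^ p * (u0 ^ p + (ENNReal.ofReal (A * x ^ (-(δ / p))) * S x ^ p⁻¹) ^ p)) := by
          gcongr; exact add_pow_le2 hp _ _
      _ = _ := by
          rw [ENNReal.mul_rpow_of_nonneg _ _ hp.le, ENNReal.rpow_inv_rpow hp.ne',
            ENNReal.ofReal_rpow_of_nonneg (by positivity) hp.le, Real.mul_rpow hA0.le (by positivity),
            ← Real.rpow_mul hx0.le, ENNReal.ofReal_mul (by positivity),
            show -(δ / p) * p = -δ by field_simp, sub_eq_add_neg, Real.rpow_add hx0,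
            ENNReal.ofReal_mul (by positivity)]
          ring
  have hint : ∫⁻ x in Set.Ioc (0 : ℝ) (1 / 2), ENNReal.ofReal (x ^ (a - δ)) * S x ≤ C₁ * ∫⁻ x, W x := by
    calc _ = ∫⁻ x in Set.Ioc (0 : ℝ) (1 / 2), ∑' i : ℕ, ENNReal.ofReal (x ^ (a - δ)) * G (2 ^ i * x) := by
          simp only [hS, ENNReal.tsum_mul_left]
      _ = ∑' i : ℕ, ∫⁻ x in Set.Ioc (0 : ℝ) (1 / 2), ENNReal.ofReal (x ^ (a - δ)) * G (2 ^ i * x) := by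
          rw [lintegral_tsum]
          intro i; apply Measurable.aemeasurable; fun_prop
      _ ≤ ∑' i : ℕ, (ENNReal.ofReal (2 ^ (-δ))) ^ i * ∫⁻ x, W x := by
          apply ENNReal.tsum_le_tsum
          intro i
          have h2i : (0 : ℝ) < 2 ^ i := by positivity
          calc _ ≤ ∫⁻ x in Set.Ioc (0 : ℝ) (1 / 2), ENNReal.ofReal ((2 ^ i) ^ (-(a - δ))) * W (2 ^ i * x) := by
                apply setLIntegral_mono' measurableSet_Ioc
                intro x hx
                by_cases hxi : 2 ^ i * x ∈ Set.Ioc (0 : ℝ) (1 / 2)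
                · rw [hG, hW, Set.indicator_of_mem hxi, Set.indicator_of_mem hxi, ← mul_assoc, ← mul_assoc,
                    ← ENNReal.ofReal_mul (by have := hx.1; positivity), ← ENNReal.ofReal_mul (by positivity)]
                  apply le_of_eq
                  congr 2
                  rw [Real.mul_rpow h2i.le hx.1.le, Real.mul_rpow h2i.le hx.1.le]
                  have e1 : ((2 : ℝ) ^ i) ^ δ = (2 ^ i) ^ (-(a - δ)) * (2 ^ i) ^ a := by
                    rw [← Real.rpow_add h2i]; congr 1; ring
                  have e2 : x ^ a = x ^ (a - δ) * x ^ δ := by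
                    rw [← Real.rpow_add hx.1]; congr 1; ring
                  rw [e1, e2]; ring
                · rw [hG, Set.indicator_of_notMem hxi]; simp
            _ ≤ ∫⁻ x, ENNReal.ofReal ((2 ^ i) ^ (-(a - δ))) * W (2 ^ i * x) := setLIntegral_le_lintegral _ _
            _ = ENNReal.ofReal ((2 ^ i) ^ (-(a - δ))) * ∫⁻ x, W (2 ^ i * x) := by
                rw [lintegral_const_mul]; fun_prop
            _ = ENNReal.ofReal ((2 ^ i) ^ (-(a - δ))) * (ENNReal.ofReal ((2 ^ i)⁻¹) * ∫⁻ x, W x) := by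
                congr 1
                have : ∫⁻ x, W (2 ^ i * x) = ∫⁻ x, W x ∂(Measure.map (2 ^ i * ·) volume) := by
                  rw [lintegral_map hWm (by fun_prop)]
                rw [this, Real.map_volume_mul_left h2i.ne', lintegral_smul_measure, abs_of_pos (by positivity),
                  smul_eq_mul]
            _ = _ := by
                rw [← mul_assoc, ← ENNReal.ofReal_mul (by positivity), ← ENNReal.ofReal_pow (by positivity)]
                congr 2
                rw [← Real.rpow_neg_one, ← Real.rpow_add h2i, ← Real.rpow_natCast, ← Real.rpow_natCast,
                  ← Real.rpow_mul (by norm_num), ← Real.rpow_mul (by norm_num)]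
                congr 1
                rw [hδd]; ring
      _ = _ := by rw [ENNReal.tsum_mul_right]
  have hWi : ∫⁻ x, W x = ∫⁻ x in Set.Ioc (0 : ℝ) (1 / 2), ENNReal.ofReal (x ^ a) * h x ^ p :=
    lintegral_indicator measurableSet_Ioc _
  rw [← hWi]
  have hSm : Measurable S := by
    apply Measurable.tsum; intro i; fun_prop
  calc _ ≤ ∫⁻ x in Set.Ioc (0 : ℝ) (1 / 2), 2 ^ p * (ENNReal.ofReal (x ^ a) * u0 ^ p +
        ENNReal.ofReal (A ^ p) * (ENNReal.ofReal (x ^ (a - δ)) * S x)) :=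
        setLIntegral_mono' measurableSet_Ioc hU
    _ = 2 ^ p * (C₀ * u0 ^ p + ENNReal.ofReal (A ^ p) *
        ∫⁻ x in Set.Ioc (0 : ℝ) (1 / 2), (ENNReal.ofReal (x ^ (a - δ)) * S x)) := by
        rw [lintegral_const_mul _ (by fun_prop), lintegral_add_left (by fun_prop),
          lintegral_mul_const _ (by fun_prop), lintegral_const_mul _ (by fun_prop)]
    _ ≤ 2 ^ p * (C₀ * u0 ^ p + ENNReal.ofReal (A ^ p) * (C₁ * ∫⁻ x, W x)) := by gcongr
    _ ≤ 2 ^ p * ((C₀ * u0 ^ p + ENNReal.ofReal (A ^ p) * (C₁ * ∫⁻ x, W x)) +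
          (C₀ * (∫⁻ x, W x) + ENNReal.ofReal (A ^ p) * C₁ * u0 ^ p)) := by
        exact mul_le_mul' le_rfl le_self_add
    _ = _ := by ring

lemma polar (n : ℕ) (hn : 1 ≤ n) (F : En n → ℝ≥0∞) (hF : Measurable F) :
    ∫⁻ z, F z ∂vol n = ∫⁻ ζ : Metric.sphere (0 : En n) 1, ∫⁻ r in Set.Ioi (0 : ℝ),
      ENNReal.ofReal (r ^ (Module.finrank ℝ (En n) - 1)) * F (r • (ζ : En n)) ∂volume ∂(vol n).toSphere := by
  have : Nonempty (Fin n) := ⟨⟨0, hn⟩⟩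
  have : Nontrivial (En n) := inferInstance
  calc ∫⁻ z, F z ∂vol n = ∫⁻ x : ({(0)}ᶜ : Set (En n)), F x ∂((vol n).comap (↑)) := by
        rw [lintegral_subtype_comap (measurableSet_singleton _).compl F,
          restrict_compl_singleton]
    _ = ∫⁻ x, F (x.2.1 • (x.1 : En n)) ∂(vol n).toSphere.prod
        (.volumeIoiPow (Module.finrank ℝ (En n) - 1)) := by
        rw [← ((vol n).measurePreserving_homeomorphUnitSphereProd).lintegral_comp_emb
          (Homeomorph.measurableEmbedding _)]
        apply lintegral_congr
        intro x
        congr 1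
        have := homeomorphUnitSphereProd_symm_apply_coe (En n) (homeomorphUnitSphereProd (En n) x)
        rw [← this]; simp
    _ = ∫⁻ ζ : Metric.sphere (0 : En n) 1, ∫⁻ r, F (r.1 • (ζ : En n))
          ∂(.volumeIoiPow (Module.finrank ℝ (En n) - 1)) ∂(vol n).toSphere := by
        rw [lintegral_prod]
        apply Measurable.aemeasurable
        fun_prop
    _ = _ := by
        apply lintegral_congr
        intro ζ
        rw [Measure.volumeIoiPow, lintegral_withDensity_eq_lintegral_mul _ (by fun_prop) (by fun_prop)]
        exact lintegral_subtype_comap measurableSet_Ioi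
          (fun r : ℝ => ENNReal.ofReal (r ^ (Module.finrank ℝ (En n) - 1)) * F (r • (ζ : En n)))

lemma refl_int (f : ℝ → ℝ≥0∞) : ∫⁻ r in Set.Ico (1 / 2 : ℝ) 1, f r =
    ∫⁻ x in Set.Ioc (0 : ℝ) (1 / 2), f (1 - x) := by
  rw [← lintegral_indicator measurableSet_Ico, ← lintegral_indicator measurableSet_Ioc,
    ← lintegral_sub_left_eq_self _ 1]
  apply lintegral_congr
  intro x
  by_cases hx : x ∈ Set.Ioc (0 : ℝ) (1 / 2)
  · have : 1 - x ∈ Set.Ico (1 / 2 : ℝ) 1 := ⟨by linarith [hx.2], by linarith [hx.1]⟩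
    rw [Set.indicator_of_mem hx, Set.indicator_of_mem this]
  · have : 1 - x ∉ Set.Ico (1 / 2 : ℝ) 1 := fun h => hx ⟨by linarith [h.2], by linarith [h.1]⟩
    rw [Set.indicator_of_notMem hx, Set.indicator_of_notMem this]

def ann (n : ℕ) : Set (En n) := {z | 1 / 2 ≤ ‖z‖ ∧ ‖z‖ < 1}

lemma meas_ann (n : ℕ) : MeasurableSet (ann n) := by
  have h : Measurable (fun z : En n => ‖z‖) := measurable_norm
  exact (measurableSet_le measurable_const h).inter (measurableSet_lt h measurable_const)

lemma polar_ann (n : ℕ) (hn : 1 ≤ n) : ∃ c : ℝ, 0 < c ∧ ∀ F : En n → ℝ≥0∞, Measurable F →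
    (∫⁻ z in ann n, F z ∂vol n ≤ ∫⁻ ζ : Metric.sphere (0 : En n) 1, ∫⁻ x in Set.Ioc (0 : ℝ) (1 / 2),
      F ((1 - x) • (ζ : En n)) ∂volume ∂(vol n).toSphere) ∧
    (ENNReal.ofReal c * ∫⁻ ζ : Metric.sphere (0 : En n) 1, ∫⁻ x in Set.Ioc (0 : ℝ) (1 / 2),
      F ((1 - x) • (ζ : En n)) ∂volume ∂(vol n).toSphere ≤ ∫⁻ z in ann n, F z ∂vol n) := by
  set m := Module.finrank ℝ (En n) - 1 with hm
  refine ⟨(1 / 2) ^ m, by positivity, fun F hF => ?_⟩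
  have e : ∫⁻ z in ann n, F z ∂vol n = ∫⁻ ζ : Metric.sphere (0 : En n) 1, ∫⁻ r in Set.Ico (1 / 2 : ℝ) 1,
      ENNReal.ofReal (r ^ m) * F (r • (ζ : En n)) ∂volume ∂(vol n).toSphere := by
    rw [← lintegral_indicator (meas_ann n), polar n hn _ (hF.indicator (meas_ann n))]
    apply lintegral_congr
    intro ζ
    rw [← lintegral_indicator measurableSet_Ioi, ← lintegral_indicator measurableSet_Ico]
    apply lintegral_congr
    intro r
    have hζ : ‖(ζ : En n)‖ = 1 := by simpa using ζ.2
    by_cases hr : 0 < r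
    · rw [Set.indicator_of_mem (show r ∈ Set.Ioi (0 : ℝ) from hr)]
      have hnr : ‖r • (ζ : En n)‖ = r := by rw [norm_smul, hζ, Real.norm_of_nonneg hr.le, mul_one]
      by_cases hr2 : r ∈ Set.Ico (1 / 2 : ℝ) 1
      · have : r • (ζ : En n) ∈ ann n := by rw [ann, Set.mem_setOf_eq, hnr]; exact hr2
        rw [Set.indicator_of_mem hr2, Set.indicator_of_mem this]
      · have : r • (ζ : En n) ∉ ann n := by rw [ann, Set.mem_setOf_eq, hnr]; exact hr2
        rw [Set.indicator_of_notMem hr2, Set.indicator_of_notMem this, mul_zero]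
    · rw [Set.indicator_of_notMem (show r ∉ Set.Ioi (0 : ℝ) from hr), Set.indicator_of_notMem]
      intro h; linarith [h.1]
  rw [e]
  constructor
  · apply lintegral_mono; intro ζ
    simp only
    rw [← refl_int (fun r => F (r • (ζ : En n)))]
    apply setLIntegral_mono' measurableSet_Ico
    intro r hr
    have h1 : ENNReal.ofReal (r ^ m) ≤ 1 := by
      rw [ENNReal.ofReal_le_one]; exact pow_le_one₀ (by linarith [hr.1]) hr.2.le
    calc _ ≤ 1 * F (r • (ζ : En n)) := by gcongr
      _ = _ := one_mul _
  · rw [← lintegral_const_mul' _ _ ENNReal.ofReal_ne_top]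
    apply lintegral_mono; intro ζ
    simp only
    rw [← refl_int (fun r => F (r • (ζ : En n))), ← lintegral_const_mul' _ _ ENNReal.ofReal_ne_top]
    apply setLIntegral_mono' measurableSet_Ico
    intro r hr
    gcongr
    exact hr.1

lemma ennorm_step {p : ℝ} (hp : 0 < p) {Y : ℝ≥0∞} {c : ℝ} (hc : 0 < c) {u v : ℂ}
    (h : Y ≠ ⊤ → ‖u‖ ≤ ‖v‖ + c * (Y ^ p⁻¹).toReal) :
    ‖u‖ₑ ≤ ‖v‖ₑ + ENNReal.ofReal c * Y ^ p⁻¹ := by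
  by_cases hY : Y = ⊤
  · rw [hY, ENNReal.top_rpow_of_pos (by positivity), ENNReal.mul_top]
    · simp
    · simpa using hc
  · have h1 := h hY
    have hB : Y ^ p⁻¹ ≠ ⊤ := by finiteness
    rw [← ofReal_norm, ← ofReal_norm]
    nth_rw 1 [← ENNReal.ofReal_toReal hB]
    rw [← ENNReal.ofReal_mul hc.le, ← ENNReal.ofReal_add (by positivity) (by positivity)]
    exact ENNReal.ofReal_le_ofReal h1

lemma rpow_cmp {x d a : ℝ} (hx : 0 < x) (h1 : x ≤ d) (h2 : d ≤ 2 * x) :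
    d ^ a ≤ 2 ^ |a| * x ^ a ∧ x ^ a ≤ 2 ^ |a| * d ^ a := by
  have hd : 0 < d := by linarith
  have h2a : (1 : ℝ) ≤ 2 ^ |a| := Real.one_le_rpow (by norm_num) (abs_nonneg a)
  rcases le_total 0 a with ha | ha
  · rw [abs_of_nonneg ha] at *
    constructor
    · rw [← Real.mul_rpow (by norm_num) hx.le]
      exact Real.rpow_le_rpow hd.le h2 ha
    · calc x ^ a ≤ d ^ a := Real.rpow_le_rpow hx.le h1 ha
        _ ≤ _ := le_mul_of_one_le_left (by positivity) h2a
  · rw [abs_of_nonpos ha] at *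
    constructor
    · calc d ^ a ≤ x ^ a := Real.rpow_le_rpow_of_nonpos hx h1 ha
        _ ≤ _ := le_mul_of_one_le_left (by positivity) h2a
    · calc x ^ a ≤ (d / 2) ^ a := Real.rpow_le_rpow_of_nonpos (by linarith) (by linarith) ha
        _ = _ := by
          rw [Real.div_rpow hd.le (by norm_num), Real.rpow_neg (by norm_num)]
          field_simp

lemma thmC (n : ℕ) (hn : 1 ≤ n) {p a : ℝ} (hp : 0 < p) (ha : -1 < a) : ∃ C : ℝ≥0∞, C ≠ ⊤ ∧
    ∀ g : En n → ℂ, DifferentiableOn ℂ g (uball n) →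
      II p a g ≤ C * (‖g 0‖ₑ ^ p + II p (a + p) (radD g)) := by
  obtain ⟨K', C₁, hC₁, h1⟩ := pt n hp 6
  obtain ⟨C₂, hC₂, h2⟩ := Avg_int n K' (a + p)
  obtain ⟨C₃, hC₃, h3⟩ := hardy hp ha
  obtain ⟨c, hc, hpol⟩ := polar_ann n hn
  -- total mass constants
  set σ := (vol n).toSphere Set.univ with hσ
  have hσt : σ ≠ ⊤ := measure_ne_top _ _
  set V := vol n (uball n) with hV
  have hVt : V ≠ ⊤ := measure_ball_lt_top.ne
  set T : ℝ := 2 ^ |a| with hT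
  set T' : ℝ := 2 ^ |a + p| with hT'
  set D₁ : ℝ≥0∞ := ENNReal.ofReal T * C₃ * σ with hD₁
  set D₂ : ℝ≥0∞ := ENNReal.ofReal T * C₃ * (ENNReal.ofReal (4 ^ p * T') * C₁) * (ENNReal.ofReal c)⁻¹ * C₂ with hD₂
  set D₃ : ℝ≥0∞ := ENNReal.ofReal T * 2 ^ p * V with hD₃
  set D₄ : ℝ≥0∞ := ENNReal.ofReal (T * T') * 2 ^ p * C₁ * C₂ with hD₄
  have hcinv : (ENNReal.ofReal c)⁻¹ ≠ ⊤ := by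
    rw [ENNReal.inv_ne_top]; simpa using hc
  refine ⟨(D₁ + D₃) + (D₂ + D₄), by finiteness, fun g hg => ?_⟩
  have hrg := holo_radD hg
  have hpm := pw_meas p hg.continuousOn
  have hprm := pw_meas p hrg.continuousOn
  have hAm := Avg_meas K' hprm
  set Y : En n → ℝ≥0∞ := fun z => C₁ * Avg K' (pw p (radD g)) z with hY
  have hYm : Measurable Y := by fun_prop
  have hdm := (continuous_dd (n := n)).measurable
  have P1 : ∀ z : En n, ‖z‖ ≤ 4 / 5 → ‖g z‖ₑ ≤ ‖g 0‖ₑ + Y z ^ p⁻¹ := by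
    intro z hz
    have hzb : z ∈ uball n := mem_ub.2 (by linarith)
    have := ennorm_step hp (Y := Y z) (c := 1) one_pos (u := g z) (v := g 0) (fun hYt => by
      rw [one_mul]
      exact C1_real hg hz (fun ξ hξ hN => le_toReal_of hp hYt (h1 _ hrg z hzb ξ hξ hN)))
    simpa using this
  have P2 : ∀ ζ : En n, ‖ζ‖ = 1 → ∀ x : ℝ, 0 < x → x ≤ 1 / 4 → ‖g ((1 - x) • ζ)‖ₑ ≤
      ‖g ((1 - 2 * x) • ζ)‖ₑ + ENNReal.ofReal (2 * x) * Y ((1 - x) • ζ) ^ p⁻¹ := by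
    intro ζ hζ x hx hx4
    have hzb : (1 - x) • ζ ∈ uball n := mem_ub.2 (by
      rw [norm_smul, hζ, Real.norm_of_nonneg (by linarith)]; linarith)
    exact ennorm_step hp (by positivity) (fun hYt =>
      C2_real hg hζ hx hx4 (fun ξ hξ hN => le_toReal_of hp hYt
        (h1 _ hrg _ hzb ξ hξ (hN.mono (by norm_num) hzb hξ))))
  have hddx : ∀ ζ : En n, ‖ζ‖ = 1 → ∀ x ∈ Set.Ioc (0 : ℝ) (1 / 2),
      x ≤ dd ((1 - x) • ζ) ∧ dd ((1 - x) • ζ) ≤ 2 * x ∧ (1 - x) • ζ ∈ uball n := by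
    intro ζ hζ x hx
    have : ‖(1 - x) • ζ‖ = 1 - x := by
      rw [norm_smul, hζ, Real.norm_of_nonneg (by linarith [hx.2]), mul_one]
    refine ⟨?_, ?_, mem_ub.2 (by rw [this]; linarith [hx.1])⟩
    · rw [dd, this]; nlinarith [hx.1, hx.2]
    · rw [dd, this]; nlinarith [hx.1, hx.2]
  have hYint : ∫⁻ z in uball n, ENNReal.ofReal (dd z ^ (a + p)) * Y z ∂vol n ≤
      C₁ * (C₂ * II p (a + p) (radD g)) := by
    calc _ = ∫⁻ z in uball n, C₁ * (ENNReal.ofReal (dd z ^ (a + p)) * Avg K' (pw p (radD g)) z) ∂vol n := by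
          apply lintegral_congr; intro z; simp only [hY]; ring
      _ = C₁ * ∫⁻ z in uball n, (ENNReal.ofReal (dd z ^ (a + p)) * Avg K' (pw p (radD g)) z) ∂vol n := by
          rw [lintegral_const_mul' _ _ hC₁]
      _ ≤ _ := by gcongr; exact h2 _ hprm
  -- annulus
  have hann : ∫⁻ z in ann n, ENNReal.ofReal (dd z ^ a) * pw p g z ∂vol n ≤
      D₁ * ‖g 0‖ₑ ^ p + D₂ * II p (a + p) (radD g) := by
    have inner1 : ∀ ζ : Metric.sphere (0 : En n) 1, ∫⁻ x in Set.Ioc (0 : ℝ) (1 / 2),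
        ENNReal.ofReal (dd ((1 - x) • (ζ : En n)) ^ a) * pw p g ((1 - x) • (ζ : En n)) ≤
        ENNReal.ofReal T * (C₃ * (‖g 0‖ₑ ^ p + ENNReal.ofReal (4 ^ p * T') *
          ∫⁻ x in Set.Ioc (0 : ℝ) (1 / 2),
            ENNReal.ofReal (dd ((1 - x) • (ζ : En n)) ^ (a + p)) * Y ((1 - x) • (ζ : En n)))) := by
      intro ζ
      have hζ : ‖(ζ : En n)‖ = 1 := by simp
      have hh := h3 (fun x => ‖g ((1 - x) • (ζ : En n))‖ₑ)
        (fun x => ENNReal.ofReal (4 * x) * Y ((1 - x) • (ζ : En n)) ^ p⁻¹) ‖g 0‖ₑ (by fun_prop)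
        (fun x hx hx4 => by
          refine (P2 ζ hζ x hx hx4).trans ?_
          gcongr
          norm_num)
        (fun x hx hx2 => by
          refine (P1 ((1 - x) • (ζ : En n)) ?_).trans ?_
          · rw [norm_smul, hζ, Real.norm_of_nonneg (by linarith)]; linarith
          · gcongr
            apply le_mul_of_one_le_left zero_le
            rw [ENNReal.one_le_ofReal]; linarith)
      calc _ ≤ ∫⁻ x in Set.Ioc (0 : ℝ) (1 / 2), ENNReal.ofReal T *
            (ENNReal.ofReal (x ^ a) * ‖g ((1 - x) • (ζ : En n))‖ₑ ^ p) := by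
            apply setLIntegral_mono' measurableSet_Ioc
            intro x hx
            obtain ⟨q1, q2, q3⟩ := hddx ζ hζ x hx
            have hx0 := hx.1
            rw [pw, Set.indicator_of_mem q3, ← mul_assoc, ← ENNReal.ofReal_mul (by positivity)]
            gcongr
            exact (rpow_cmp hx.1 q1 q2).1
        _ = ENNReal.ofReal T * ∫⁻ x in Set.Ioc (0 : ℝ) (1 / 2),
            (ENNReal.ofReal (x ^ a) * ‖g ((1 - x) • (ζ : En n))‖ₑ ^ p) := by
            rw [lintegral_const_mul' _ _ ENNReal.ofReal_ne_top]
        _ ≤ _ := by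
            gcongr
            refine hh.trans ?_
            gcongr
            rw [← lintegral_const_mul' _ _ ENNReal.ofReal_ne_top]
            apply setLIntegral_mono' measurableSet_Ioc
            intro x hx
            obtain ⟨q1, q2, q3⟩ := hddx ζ hζ x hx
            have hx0 := hx.1
            have hd0 : 0 < dd ((1 - x) • (ζ : En n)) := by linarith
            rw [ENNReal.mul_rpow_of_nonneg _ _ hp.le, ENNReal.rpow_inv_rpow hp.ne',
              ENNReal.ofReal_rpow_of_nonneg (by positivity) hp.le,
              ← mul_assoc (ENNReal.ofReal (x ^ a)), ← mul_assoc (ENNReal.ofReal (4 ^ p * T')),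
              ← ENNReal.ofReal_mul (by positivity), ← ENNReal.ofReal_mul (by positivity)]
            refine mul_le_mul' (ENNReal.ofReal_le_ofReal ?_) le_rfl
            have := (rpow_cmp (a := a + p) hx.1 q1 q2).2
            rw [Real.mul_rpow (by norm_num) hx0.le, mul_left_comm, ← Real.rpow_add hx0, mul_assoc]
            gcongr
    have hH := (hpol (fun z => ENNReal.ofReal (dd z ^ a) * pw p g z) (by fun_prop)).1
    have hH2 := (hpol (fun z => ENNReal.ofReal (dd z ^ (a + p)) * Y z) (by fun_prop)).2
    set J := ∫⁻ ζ : Metric.sphere (0 : En n) 1, ∫⁻ x in Set.Ioc (0 : ℝ) (1 / 2),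
            ENNReal.ofReal (dd ((1 - x) • (ζ : En n)) ^ (a + p)) * Y ((1 - x) • (ζ : En n)) ∂volume
            ∂(vol n).toSphere with hJ
    have hJ2 : J ≤ (ENNReal.ofReal c)⁻¹ * (C₁ * (C₂ * II p (a + p) (radD g))) := by
      rw [mul_comm, ← div_eq_mul_inv, ENNReal.le_div_iff_mul_le (by left; simpa using hc) (by left; simp), mul_comm]
      refine hH2.trans (le_trans ?_ hYint)
      apply lintegral_mono_set
      intro z hz
      exact mem_ub.2 hz.2
    calc _ ≤ _ := hH
      _ ≤ ∫⁻ ζ : Metric.sphere (0 : En n) 1, ENNReal.ofReal T * (C₃ * (‖g 0‖ₑ ^ p + ENNReal.ofReal (4 ^ p * T') *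
          ∫⁻ x in Set.Ioc (0 : ℝ) (1 / 2),
            ENNReal.ofReal (dd ((1 - x) • (ζ : En n)) ^ (a + p)) * Y ((1 - x) • (ζ : En n)) ∂volume))
            ∂(vol n).toSphere := lintegral_mono inner1
      _ = ENNReal.ofReal T * (C₃ * (‖g 0‖ₑ ^ p * σ + ENNReal.ofReal (4 ^ p * T') * J)) := by
          rw [lintegral_const_mul' _ _ ENNReal.ofReal_ne_top, lintegral_const_mul' _ _ hC₃,
            lintegral_add_left measurable_const, lintegral_const, lintegral_const_mul' _ _ ENNReal.ofReal_ne_top]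
      _ ≤ ENNReal.ofReal T * (C₃ * (‖g 0‖ₑ ^ p * σ + ENNReal.ofReal (4 ^ p * T') *
            ((ENNReal.ofReal c)⁻¹ * (C₁ * (C₂ * II p (a + p) (radD g)))))) := by gcongr
      _ = _ := by rw [hD₁, hD₂]; ring
  have hcen : ∫⁻ z in uball n \ ann n, ENNReal.ofReal (dd z ^ a) * pw p g z ∂vol n ≤
      D₃ * ‖g 0‖ₑ ^ p + D₄ * II p (a + p) (radD g) := by
    calc _ ≤ ∫⁻ z in uball n \ ann n, (ENNReal.ofReal T * 2 ^ p * ‖g 0‖ₑ ^ p +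
          ENNReal.ofReal (T * T') * 2 ^ p * (ENNReal.ofReal (dd z ^ (a + p)) * Y z)) ∂vol n := by
          apply setLIntegral_mono' (isOpen_ub.measurableSet.diff (meas_ann n))
          intro z hz
          have hz1 := mem_ub.1 hz.1
          have hz2 : ‖z‖ < 1 / 2 := by
            by_contra hcon
            exact hz.2 ⟨not_lt.1 hcon, hz1⟩
          have hd1 : dd z ≤ 1 := dd_le_one z
          have hd2 : 1 / 2 ≤ dd z := by rw [dd]; nlinarith [norm_nonneg z]
          have hd0 : 0 < dd z := by linarith
          have r1 := (rpow_cmp (a := a) (x := dd z) (d := 1) hd0 hd1 (by linarith)).2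
          have r2 := (rpow_cmp (a := a + p) (x := dd z) (d := 1) hd0 hd1 (by linarith)).1
          rw [Real.one_rpow, mul_one] at r1
          rw [Real.one_rpow] at r2
          rw [pw, Set.indicator_of_mem hz.1]
          have hgz : ‖g z‖ₑ ^ p ≤ 2 ^ p * (‖g 0‖ₑ ^ p + Y z) := by
            calc _ ≤ (‖g 0‖ₑ + Y z ^ p⁻¹) ^ p := by
                  gcongr; exact P1 z (by linarith)
              _ ≤ _ := add_pow_le2 hp _ _
              _ = _ := by rw [ENNReal.rpow_inv_rpow hp.ne']
          have r3 : (1 : ℝ≥0∞) ≤ ENNReal.ofReal T' * ENNReal.ofReal (dd z ^ (a + p)) := by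
            rw [← ENNReal.ofReal_mul (by positivity), ENNReal.one_le_ofReal]; exact r2
          calc _ ≤ ENNReal.ofReal T * (2 ^ p * (‖g 0‖ₑ ^ p + Y z)) := by gcongr
            _ = ENNReal.ofReal T * 2 ^ p * ‖g 0‖ₑ ^ p + ENNReal.ofReal T * 2 ^ p * Y z * 1 := by ring
            _ ≤ ENNReal.ofReal T * 2 ^ p * ‖g 0‖ₑ ^ p + ENNReal.ofReal T * 2 ^ p * Y z *
                (ENNReal.ofReal T' * ENNReal.ofReal (dd z ^ (a + p))) := by gcongr
            _ = _ := by rw [ENNReal.ofReal_mul (by positivity)]; ring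
      _ ≤ ∫⁻ z in uball n, (ENNReal.ofReal T * 2 ^ p * ‖g 0‖ₑ ^ p +
          ENNReal.ofReal (T * T') * 2 ^ p * (ENNReal.ofReal (dd z ^ (a + p)) * Y z)) ∂vol n :=
          lintegral_mono_set Set.sdiff_subset
      _ = ENNReal.ofReal T * 2 ^ p * ‖g 0‖ₑ ^ p * V + ENNReal.ofReal (T * T') * 2 ^ p *
          ∫⁻ z in uball n, (ENNReal.ofReal (dd z ^ (a + p)) * Y z) ∂vol n := by
          rw [lintegral_add_left measurable_const, setLIntegral_const, lintegral_const_mul' _ _ (by finiteness)]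
      _ ≤ ENNReal.ofReal T * 2 ^ p * ‖g 0‖ₑ ^ p * V + ENNReal.ofReal (T * T') * 2 ^ p *
          (C₁ * (C₂ * II p (a + p) (radD g))) := by gcongr
      _ = _ := by rw [hD₃, hD₄]; ring
  have hsplit : II p a g ≤ ∫⁻ z in ann n, ENNReal.ofReal (dd z ^ a) * pw p g z ∂vol n +
      ∫⁻ z in uball n \ ann n, ENNReal.ofReal (dd z ^ a) * pw p g z ∂vol n := by
    rw [II]
    refine le_trans ?_ (lintegral_union_le _ _ _)
    apply lintegral_mono_set
    intro z hz
    by_cases h : z ∈ ann n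
    · exact Or.inl h
    · exact Or.inr ⟨hz, h⟩
  calc _ ≤ _ := hsplit
    _ ≤ (D₁ * ‖g 0‖ₑ ^ p + D₂ * II p (a + p) (radD g)) +
        (D₃ * ‖g 0‖ₑ ^ p + D₄ * II p (a + p) (radD g)) := add_le_add hann hcen
    _ = (D₁ + D₃) * ‖g 0‖ₑ ^ p + (D₂ + D₄) * II p (a + p) (radD g) := by ring
    _ ≤ ((D₁ + D₃) + (D₂ + D₄)) * ‖g 0‖ₑ ^ p + ((D₁ + D₃) + (D₂ + D₄)) * II p (a + p) (radD g) := by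
        exact add_le_add (mul_le_mul' le_self_add le_rfl) (mul_le_mul' le_add_self le_rfl)
    _ = _ := by ring

lemma chainB (n : ℕ) {p : ℝ} (hp : 0 < p) (α : ℝ) (N j : ℕ) : ∃ C : ℝ≥0∞, C ≠ ⊤ ∧ ∀ f : En n → ℂ,
    DifferentiableOn ℂ f (uball n) →
    II p (p * (N + j : ℕ) + α) (radIter (N + j) f) ≤ C * II p (p * N + α) (radIter N f) := by
  induction j with
  | zero => exact ⟨1, by simp, fun f _ => by simp⟩
  | succ j ih =>
    obtain ⟨C, hC, h⟩ := ih
    obtain ⟨C', hC', h'⟩ := thmB n hp (p * (N + j : ℕ) + α)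
    refine ⟨C' * C, by finiteness, fun f hf => ?_⟩
    have := h' (radIter (N + j) f) (holo_radIter hf _)
    have e : p * (N + (j + 1) : ℕ) + α = p * (N + j : ℕ) + α + p := by push_cast; ring
    rw [e]
    calc _ ≤ _ := this
      _ ≤ C' * (C * II p (p * N + α) (radIter N f)) := by gcongr; exact h f hf
      _ = _ := by ring

lemma chainC (n : ℕ) (hn : 1 ≤ n) {p : ℝ} (hp : 0 < p) (α : ℝ) (N : ℕ) (hN : p * N + α > -1) (j : ℕ) :
    ∃ C : ℝ≥0∞, C ≠ ⊤ ∧ ∀ f : En n → ℂ, DifferentiableOn ℂ f (uball n) →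
    II p (p * N + α) (radIter N f) ≤
      C * (‖f 0‖ₑ ^ p + II p (p * (N + j : ℕ) + α) (radIter (N + j) f)) := by
  induction j with
  | zero => exact ⟨1, by simp, fun f _ => by rw [one_mul]; exact le_add_self⟩
  | succ j ih =>
    obtain ⟨C, hC, h⟩ := ih
    have ha : -1 < p * (N + j : ℕ) + α := by
      push_cast
      have : 0 ≤ p * j := by positivity
      linarith
    obtain ⟨C', hC', h'⟩ := thmC n hn hp ha
    refine ⟨C + C * C', by finiteness, fun f hf => ?_⟩
    have h1 := h' (radIter (N + j) f) (holo_radIter hf _)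
    have e : p * (N + (j + 1) : ℕ) + α = p * (N + j : ℕ) + α + p := by push_cast; ring
    have h0 : ‖radIter (N + j) f 0‖ₑ ^ p ≤ ‖f 0‖ₑ ^ p := by
      gcongr
      rcases Nat.eq_zero_or_pos (N + j) with hz | hz
      · rw [hz]; exact le_rfl
      · obtain ⟨m, hm⟩ := Nat.exists_eq_succ_of_ne_zero hz.ne'
        rw [hm, Nat.succ_eq_add_one, radIter_zero]; simp
    rw [e]
    set X := II p (p * (N + j : ℕ) + α + p) (radIter (N + (j + 1)) f) with hX
    have h1' : II p (p * (N + j : ℕ) + α) (radIter (N + j) f) ≤ C' * (‖f 0‖ₑ ^ p + X) := by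
      refine h1.trans ?_
      exact mul_le_mul' le_rfl (add_le_add h0 le_rfl)
    calc _ ≤ _ := h f hf
      _ ≤ C * (‖f 0‖ₑ ^ p + C' * (‖f 0‖ₑ ^ p + X)) := by gcongr
      _ ≤ C * ((‖f 0‖ₑ ^ p + X) + C' * (‖f 0‖ₑ ^ p + X)) := by gcongr; exact le_self_add
      _ = _ := by ring

lemma cnorm_pos (n : ℕ) (α : ℝ) : 0 < cnorm n α := by
  rw [cnorm]
  split_ifs with h
  · have h1 : 0 < Real.Gamma (n + α + 1) := Real.Gamma_pos_of_pos (by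
      have : (0 : ℝ) ≤ n := by positivity
      linarith)
    have h2 : 0 < Real.Gamma (α + 1) := Real.Gamma_pos_of_pos (by linarith)
    positivity
  · exact one_pos

lemma lint_measA (n : ℕ) (α : ℝ) (F : En n → ℝ≥0∞) : ∫⁻ z, F z ∂measA n α =
    ENNReal.ofReal (cnorm n α) * ∫⁻ z in uball n, ENNReal.ofReal (dd z ^ α) * F z ∂vol n := by
  have hdm := (continuous_dd (n := n)).measurable
  have hm : Measurable (fun z : En n => ENNReal.ofReal (cnorm n α * (1 - ‖z‖ ^ 2) ^ α)) := by
    have : Measurable (fun z : En n => ENNReal.ofReal (cnorm n α * dd z ^ α)) := by fun_prop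
    exact this
  rw [measA, lintegral_withDensity_eq_lintegral_mul_non_measurable _ hm
    (Eventually.of_forall fun z => ENNReal.ofReal_lt_top), ← lintegral_const_mul' _ _ ENNReal.ofReal_ne_top]
  apply lintegral_congr
  intro z
  simp only [Pi.mul_apply]
  rw [ENNReal.ofReal_mul (cnorm_pos n α).le, mul_assoc]
  rfl

lemma lint_II (n : ℕ) {p : ℝ} (hp : 0 < p) (α k : ℝ) (g : En n → ℂ) :
    ∫⁻ z, ENNReal.ofReal ((1 - ‖z‖ ^ 2) ^ (p * k) * ‖g z‖ ^ p) ∂measA n α =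
      ENNReal.ofReal (cnorm n α) * II p (p * k + α) g := by
  rw [lint_measA, II]
  congr 1
  apply setLIntegral_congr_fun isOpen_ub.measurableSet
  intro z hz
  have hz' := mem_ub'.1 hz
  simp only
  rw [pw, Set.indicator_of_mem hz, add_comm, Real.rpow_add hz', ENNReal.ofReal_mul (by positivity),
    ENNReal.ofReal_mul (Real.rpow_nonneg hz'.le _), ← ENNReal.ofReal_rpow_of_nonneg (norm_nonneg _) hp.le,
    ofReal_norm, mul_assoc]
  rfl

lemma root_le {p : ℝ} (hp : 0 < p) {A X u : ℝ≥0∞} {C : ℝ≥0∞} (h : A ≤ C * (u ^ p + X)) :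
    u + A ^ (1 / p) ≤ (1 + C ^ (1 / p) * 2 ^ (1 / p)) * (u + X ^ (1 / p)) := by
  have hp' : 0 < 1 / p := by positivity
  have h1 : A ^ (1 / p) ≤ C ^ (1 / p) * (2 ^ (1 / p) * (u + X ^ (1 / p))) := by
    calc _ ≤ (C * (u ^ p + X)) ^ (1 / p) := by gcongr
      _ = C ^ (1 / p) * (u ^ p + X) ^ (1 / p) := ENNReal.mul_rpow_of_nonneg _ _ hp'.le
      _ ≤ C ^ (1 / p) * (2 ^ (1 / p) * ((u ^ p) ^ (1 / p) + X ^ (1 / p))) := by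
          gcongr; exact add_pow_le2 hp' _ _
      _ = _ := by rw [one_div, ENNReal.rpow_rpow_inv hp.ne']
  calc _ ≤ (u + X ^ (1 / p)) + C ^ (1 / p) * (2 ^ (1 / p) * (u + X ^ (1 / p))) :=
        add_le_add le_self_add h1
    _ = _ := by ring

/-- Maximal function characterization of the generalized Bergman spaces. -/
theorem stmt6 (n : ℕ) (hn : 1 ≤ n) (γ α p : ℝ) (k : ℕ) (hγ : 0 < γ) (hp : 0 < p)
    (hk : p * k + α > -1) :
    ∃ C : ℝ≥0∞, 0 < C ∧ C < ⊤ ∧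
      ∀ f : En n → ℂ, DifferentiableOn ℂ f (uball n) →
        ((gapnorm n p α f < ⊤ ↔
            (∫⁻ z, (maxF γ (fun w => (1 - ‖w‖ ^ 2) ^ (k : ℝ) * ‖radIter k f w‖) z) ^ p
              ∂measA n α) < ⊤) ∧
         C⁻¹ * (ENNReal.ofReal ‖f 0‖ +
              (∫⁻ z, (maxF γ (fun w => (1 - ‖w‖ ^ 2) ^ (k : ℝ) * ‖radIter k f w‖) z) ^ p
                ∂measA n α) ^ (1 / p)) ≤ gapnorm n p α f ∧
         gapnorm n p α f ≤
            C * (ENNReal.ofReal ‖f 0‖ +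
              (∫⁻ z, (maxF γ (fun w => (1 - ‖w‖ ^ 2) ^ (k : ℝ) * ‖radIter k f w‖) z) ^ p
                ∂measA n α) ^ (1 / p))) := by
  have hN1 : p * (Nmin p α : ℕ) + α > -1 := Nat.sInf_mem (s := {k : ℕ | p * k + α > -1}) ⟨k, hk⟩
  have hN2 : Nmin p α ≤ k := Nat.sInf_le (s := {k : ℕ | p * k + α > -1}) hk
  set N := Nmin p α with hN
  obtain ⟨j, rfl⟩ := Nat.exists_eq_add_of_le hN2
  obtain ⟨C₁, hC₁, h1⟩ := chainB n hp α N j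
  obtain ⟨C₂, hC₂, h2⟩ := chainC n hn hp α N hN1 j
  obtain ⟨C₃, hC₃, h3⟩ := thmA n hp γ α ((N + j : ℕ) : ℝ)
  set c : ℝ≥0∞ := ENNReal.ofReal (cnorm n α) with hc
  have hc0 : c ≠ 0 := by simpa [hc] using cnorm_pos n α
  have hct : c ≠ ⊤ := ENNReal.ofReal_ne_top
  set E₁ : ℝ≥0∞ := C₃ * C₁ with hE₁
  set E₂ : ℝ≥0∞ := C₂ * (c + 1) with hE₂
  set C : ℝ≥0∞ := (1 + E₁ ^ (1 / p) * 2 ^ (1 / p)) + (1 + E₂ ^ (1 / p) * 2 ^ (1 / p)) with hCdef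
  have hp' : 0 < 1 / p := by positivity
  have hCt : C ≠ ⊤ := by finiteness
  have hC0 : C ≠ 0 := by simp [hCdef]
  refine ⟨C, pos_iff_ne_zero.2 hC0, lt_top_iff_ne_top.2 hCt, fun f hf => ?_⟩
  set u : ℝ≥0∞ := ENNReal.ofReal ‖f 0‖ with hu
  have hue : u = ‖f 0‖ₑ := ofReal_norm _
  have hut : u ≠ ⊤ := ENNReal.ofReal_ne_top
  set J := ∫⁻ z, (maxF γ (fun w => (1 - ‖w‖ ^ 2) ^ ((N + j : ℕ) : ℝ) * ‖radIter (N + j) f w‖) z) ^ p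
              ∂measA n α with hJ
  set I := ∫⁻ z, ENNReal.ofReal ((1 - ‖z‖ ^ 2) ^ (p * N) * ‖radIter N f z‖ ^ p) ∂measA n α with hI
  have hg : gapnorm n p α f = u + I ^ (1 / p) := rfl
  have eI : I = c * II p (p * N + α) (radIter N f) := lint_II n hp α N _
  have eJ := lint_measA n α (fun z => (maxF γ (fun w => (1 - ‖w‖ ^ 2) ^ ((N + j : ℕ) : ℝ) * ‖radIter (N + j) f w‖) z) ^ p)
  rw [← hJ, ← hc] at eJ
  have hholo := holo_radIter hf (N + j)
  have hJI : J ≤ E₁ * (u ^ p + I) := by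
    rw [eJ, eI]
    calc _ ≤ c * (C₃ * (C₁ * II p (p * N + α) (radIter N f))) := by
          gcongr
          exact (h3 _ hholo).trans (mul_le_mul' le_rfl (h1 f hf))
      _ = E₁ * (c * II p (p * N + α) (radIter N f)) := by rw [hE₁]; ring
      _ ≤ _ := mul_le_mul' le_rfl le_add_self
  have hIJ : I ≤ E₂ * (u ^ p + J) := by
    have q := thmA' n hp hγ α ((N + j : ℕ) : ℝ) (radIter (N + j) f)
    have q2 : c * II p (p * ((N + j : ℕ) : ℝ) + α) (radIter (N + j) f) ≤ J := by
      rw [eJ]; exact mul_le_mul' le_rfl q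
    rw [eI, hue]
    calc _ ≤ c * (C₂ * (‖f 0‖ₑ ^ p + II p (p * (N + j : ℕ) + α) (radIter (N + j) f))) := by
          gcongr; exact h2 f hf
      _ = C₂ * (c * ‖f 0‖ₑ ^ p + c * II p (p * (N + j : ℕ) + α) (radIter (N + j) f)) := by ring
      _ ≤ C₂ * (c * ‖f 0‖ₑ ^ p + J) := by gcongr
      _ ≤ C₂ * ((c * ‖f 0‖ₑ ^ p + J) + (‖f 0‖ₑ ^ p + c * J)) := mul_le_mul' le_rfl le_self_add
      _ = _ := by rw [hE₂]; ring
  have g1 : u + J ^ (1 / p) ≤ C * (u + I ^ (1 / p)) :=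
    (root_le hp hJI).trans (mul_le_mul' le_self_add le_rfl)
  have g2 : u + I ^ (1 / p) ≤ C * (u + J ^ (1 / p)) :=
    (root_le hp hIJ).trans (mul_le_mul' le_add_self le_rfl)
  rw [hg]
  refine ⟨⟨fun h => ?_, fun h => ?_⟩, ?_, g2⟩
  · have h4 : J ^ (1 / p) < ⊤ := lt_of_le_of_lt le_add_self
      (lt_of_le_of_lt g1 (ENNReal.mul_lt_top (lt_top_iff_ne_top.2 hCt) h))
    exact (ENNReal.rpow_lt_top_iff_of_pos hp').1 h4
  · have h5 : J ^ (1 / p) < ⊤ := (ENNReal.rpow_lt_top_iff_of_pos hp').2 h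
    exact lt_of_le_of_lt g2 (ENNReal.mul_lt_top (lt_top_iff_ne_top.2 hCt)
      (ENNReal.add_lt_top.2 ⟨lt_top_iff_ne_top.2 hut, h5⟩))
  · rw [mul_comm, ← div_eq_mul_inv]
    exact ENNReal.div_le_of_le_mul' g1
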